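/- arXiv:2509.11008 — 7 statements merged into one kernel-verified Lean document; each statement's English description precedes it below -/
import Mathlib

section
/- (Brezis–Lieb lemma in Musielak–Orlicz spaces) Let (Ω, Σ, μ) be a σ-finite measure space and let Φ be a generalized Young function on Ω satisfying the elasticity condition (D22) with constants 1 < m ≤ ℓ < ∞. Let {u_n} be a sequence of measurable functions with sup_n ‖u_n‖_{L^Φ_μ} < ∞ and u_n(x) → u(x) for μ-a.e. x ∈ Ω. Then u ∈ L^Φ_μ(Ω) and lim_{n→∞} ∫_Ω |Φ(x,|u_n|) − Φ(x,|u_n − u|) − Φ(x,|u|)| dμ = 0. -/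
open Set MeasureTheory Filter Topology

/-- The modular `ρ_Φ(u) = ∫_Ω Φ(x,|u(x)|) dμ` of a Musielak–Orlicz space. -/
noncomputable def mmodular {α : Type*} [MeasurableSpace α] (μ : Measure α)
    (Φ : α → ℝ → ℝ) (u : α → ℝ) : ENNReal :=
  ∫⁻ x, ENNReal.ofReal (Φ x |u x|) ∂μ

/-- Membership in the Musielak–Orlicz space `L^Φ_μ(Ω)`:
`u` is measurable and `ρ_Φ(λ u) < ∞` for some `λ > 0`. -/
def MemLPhi {α : Type*} [MeasurableSpace α] (μ : Measure α)
    (Φ : α → ℝ → ℝ) (u : α → ℝ) : Prop :=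
  AEMeasurable u μ ∧ ∃ lam : ℝ, 0 < lam ∧ mmodular μ Φ (fun x => lam * u x) < ⊤

/-- The Luxemburg norm `‖u‖_{L^Φ_μ} = inf {λ > 0 : ρ_Φ(u/λ) ≤ 1}`. -/
noncomputable def luxNorm {α : Type*} [MeasurableSpace α] (μ : Measure α)
    (Φ : α → ℝ → ℝ) (u : α → ℝ) : ℝ :=
  sInf {lam : ℝ | 0 < lam ∧ mmodular μ Φ (fun x => u x / lam) ≤ 1}

/-- A nonnegative convex function on `[0, ∞)` vanishing at the origin with power-type growth
`F (k t) ≤ k ^ ℓ F t` for `k ≥ 1`. -/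
structure IsDoublingYoung (ℓ : ℝ) (F : ℝ → ℝ) : Prop where
  convexOn : ConvexOn ℝ (Set.Ici (0 : ℝ)) F
  nonneg : ∀ t, 0 ≤ t → 0 ≤ F t
  map_zero : F 0 = 0
  map_mul_le : ∀ k t, 1 ≤ k → 0 ≤ t → F (k * t) ≤ k ^ ℓ * F t

/-- An upper elasticity bound `t F'(t) / F(t) ≤ ℓ` gives the growth bound
`F (k t) ≤ k ^ ℓ F t`. -/
theorem map_mul_le_rpow_of_elasticity_le {F f : ℝ → ℝ} {ℓ : ℝ} (h0 : F 0 = 0)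
    (hd : ∀ t, 0 < t → HasDerivAt F (f t) t) (hpos : ∀ t, 0 < t → 0 < F t)
    (hel : ∀ t, 0 < t → t * f t / F t ≤ ℓ) {k t : ℝ} (hk : 1 ≤ k) (ht : 0 ≤ t) :
    F (k * t) ≤ k ^ ℓ * F t := by
  rcases ht.eq_or_lt with rfl | ht
  · simp [h0]
  have hk0 : 0 < k := by linarith
  have hder : ∀ s : ℝ, 0 < s →
      HasDerivAt (fun s => F s * s ^ (-ℓ)) (f s * s ^ (-ℓ) + F s * (-ℓ * s ^ (-ℓ - 1))) s :=
    fun s hs => (hd s hs).mul (Real.hasDerivAt_rpow_const (Or.inl hs.ne'))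
  have hanti : AntitoneOn (fun s => F s * s ^ (-ℓ)) (Set.Ioi (0 : ℝ)) := by
    apply antitoneOn_of_deriv_nonpos (convex_Ioi 0)
    · exact fun s hs => (hder s hs).continuousAt.continuousWithinAt
    · rw [interior_Ioi]
      exact fun s hs => (hder s hs).differentiableAt.differentiableWithinAt
    · rw [interior_Ioi]
      intro s hs
      have hs : 0 < s := hs
      rw [(hder s hs).deriv]
      have h1 := (div_le_iff₀ (hpos s hs)).1 (hel s hs)
      have h2 : s ^ (-ℓ) = s ^ (-ℓ - 1) * s := by
        rw [← Real.rpow_add_one hs.ne']; ring_nf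
      have h3 : 0 < s ^ (-ℓ - 1) := Real.rpow_pos_of_pos hs _
      rw [h2]
      nlinarith [mul_nonneg h3.le (sub_nonneg.2 h1)]
  have hkt : 0 < k * t := mul_pos hk0 ht
  have h := hanti (Set.mem_Ioi.2 ht) (Set.mem_Ioi.2 hkt) (by nlinarith)
  simp only [Real.mul_rpow hk0.le ht.le, Real.rpow_neg hk0.le, Real.rpow_neg ht.le] at h
  have h4 : 0 < k ^ ℓ := Real.rpow_pos_of_pos hk0 _
  have h5 : 0 < t ^ ℓ := Real.rpow_pos_of_pos ht _
  field_simp at h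
  linarith

namespace IsDoublingYoung

variable {ℓ : ℝ} {F : ℝ → ℝ}

theorem map_mul_le_self (hF : IsDoublingYoung ℓ F) {c t : ℝ} (hc : 0 ≤ c) (hc1 : c ≤ 1)
    (ht : 0 ≤ t) : F (c * t) ≤ c * F t := by
  have h := hF.convexOn.2 (Set.mem_Ici.2 ht) (Set.mem_Ici.2 le_rfl) hc (sub_nonneg.2 hc1)
    (by ring)
  simpa [hF.map_zero] using h

theorem mono (hF : IsDoublingYoung ℓ F) {s t : ℝ} (hs : 0 ≤ s) (hst : s ≤ t) : F s ≤ F t := by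
  rcases (hs.trans hst).eq_or_lt with h | ht
  · rw [le_antisymm hst (h ▸ hs)]
  · have h1 : s / t ≤ 1 := (div_le_one ht).2 hst
    have h := hF.map_mul_le_self (div_nonneg hs ht.le) h1 ht.le
    rw [div_mul_cancel₀ _ ht.ne'] at h
    exact h.trans (mul_le_of_le_one_left (hF.nonneg t ht.le) h1)

end IsDoublingYoung

/-- The constant in the almost-subadditivity bound depends only on `ε` and the exponent. -/
theorem exists_forall_map_add_le (ℓ : ℝ) {ε : ℝ} (hε : 0 < ε) :
    ∃ C : ℝ, 0 ≤ C ∧ ∀ F : ℝ → ℝ, IsDoublingYoung ℓ F → ∀ s t : ℝ, 0 ≤ s → 0 ≤ t →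
      F (s + t) ≤ (1 + ε) * F s + C * F t := by
  have hcont : Tendsto (fun δ : ℝ => (1 - δ) * ((1 - δ)⁻¹) ^ ℓ) (𝓝[>] 0) (𝓝 1) := by
    have : ContinuousAt (fun δ : ℝ => (1 - δ) * ((1 - δ)⁻¹) ^ ℓ) 0 := by
      have h1 : ContinuousAt (fun δ : ℝ => 1 - δ) 0 := by fun_prop
      exact h1.mul ((h1.inv₀ (by norm_num)).rpow_const (Or.inl (by norm_num)))
    simpa using this.tendsto.mono_left nhdsWithin_le_nhds
  obtain ⟨δ, hδε, hδ0, hδ1⟩ := ((hcont.eventually_lt_const (by linarith : 1 < 1 + ε)).and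
    (Ioo_mem_nhdsGT (zero_lt_one (α := ℝ)))).exists
  have h1δ : 0 < 1 - δ := by linarith
  refine ⟨δ * (δ⁻¹) ^ ℓ, by positivity, fun F hF s t hs ht => ?_⟩
  have hconv := hF.convexOn.2 (Set.mem_Ici.2 (by positivity : 0 ≤ (1 - δ)⁻¹ * s))
    (Set.mem_Ici.2 (by positivity : 0 ≤ δ⁻¹ * t)) h1δ.le hδ0.le (by ring)
  simp only [smul_eq_mul, mul_inv_cancel_left₀ h1δ.ne', mul_inv_cancel_left₀ hδ0.ne'] at hconv
  have hs' := hF.map_mul_le (1 - δ)⁻¹ s ((one_le_inv₀ h1δ).2 (by linarith)) hs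
  have ht' := hF.map_mul_le δ⁻¹ t ((one_le_inv₀ hδ0).2 hδ1.le) ht
  calc F (s + t) ≤ _ := hconv
    _ ≤ (1 - δ) * ((1 - δ)⁻¹ ^ ℓ * F s) + δ * (δ⁻¹ ^ ℓ * F t) := by gcongr
    _ = ((1 - δ) * (1 - δ)⁻¹ ^ ℓ) * F s + δ * δ⁻¹ ^ ℓ * F t := by ring
    _ ≤ _ := by
      gcongr
      exact hF.nonneg s hs

/-- The pointwise Brezis–Lieb inequality, uniform over Young functions with the same growth
exponent. -/
theorem exists_forall_abs_sub_sub_le (ℓ : ℝ) {ε : ℝ} (hε : 0 < ε) (hε1 : ε ≤ 1) :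
    ∃ C : ℝ, 0 ≤ C ∧ ∀ F : ℝ → ℝ, IsDoublingYoung ℓ F → ∀ a b : ℝ,
      abs (F |a| - F |a - b| - F |b|) ≤ 2 * ε * F |a - b| + C * F |b| := by
  obtain ⟨C, hC, h⟩ := exists_forall_map_add_le ℓ hε
  refine ⟨2 * C + 1, by positivity, fun F hF a b => ?_⟩
  have hA := hF.nonneg _ (abs_nonneg (a - b))
  have hB := hF.nonneg _ (abs_nonneg b)
  have h1 : F |a| ≤ (1 + ε) * F |a - b| + C * F |b| :=
    (hF.mono (abs_nonneg a) (by simpa using abs_add_le (a - b) b)).trans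
      (h F hF _ _ (abs_nonneg _) (abs_nonneg _))
  have h2 : F |a - b| ≤ (1 + ε) * F |a| + C * F |b| :=
    (hF.mono (abs_nonneg _) (abs_sub a b)).trans
      (h F hF _ _ (abs_nonneg _) (abs_nonneg _))
  have hεA := mul_nonneg hε.le hA
  have hCB := mul_nonneg hC hB
  have hε2 : ε * (ε * F |a - b|) ≤ ε * F |a - b| := mul_le_of_le_one_left hεA hε1
  have hεCB : ε * (C * F |b|) ≤ C * F |b| := mul_le_of_le_one_left hCB hε1
  have h3 := mul_le_mul_of_nonneg_left h1 hε.le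
  rw [abs_le]
  constructor <;> nlinarith

theorem tendsto_comp_abs {F : ℝ → ℝ} (hF : ContinuousOn F (Set.Ici (0 : ℝ))) {w : ℕ → ℝ} {a : ℝ}
    (hw : Tendsto w atTop (𝓝 a)) : Tendsto (fun n => F |w n|) atTop (𝓝 (F |a|)) :=
  (hF _ (abs_nonneg a)).tendsto.comp
    (tendsto_nhdsWithin_iff.2 ⟨hw.abs, Eventually.of_forall fun n => abs_nonneg (w n)⟩)

section Modular

variable {α : Type*} [MeasurableSpace α] {μ : Measure α} {Φ : α → ℝ → ℝ} {ℓ : ℝ}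

/-- Superposition with a Carathéodory integrand preserves a.e. measurability. -/
theorem aemeasurable_comp_abs (hmeas : ∀ t : ℝ, 0 ≤ t → Measurable fun x => Φ x t)
    (hcont : ∀ᵐ x ∂μ, ContinuousOn (Φ x) (Set.Ici (0 : ℝ))) {w : α → ℝ}
    (hw : AEMeasurable w μ) : AEMeasurable (fun x => Φ x |w x|) μ := by
  classical
  set N := toMeasurable μ {x | ¬ ContinuousOn (Φ x) (Set.Ici (0 : ℝ))}
  have hN : MeasurableSet N := measurableSet_toMeasurable _ _
  have hN0 : μ N = 0 := by rw [measure_toMeasurable]; exact hcont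
  have hgood : ∀ x, x ∉ N → ContinuousOn (Φ x) (Set.Ici (0 : ℝ)) := fun x hx => by
    by_contra h
    exact hx (subset_toMeasurable _ _ h)
  have hΨ : Measurable (Function.uncurry fun (t : ℝ) (x : α) => if x ∈ N then 0 else Φ x |t|) := by
    apply measurable_uncurry_of_continuous_of_measurable
    · intro x
      by_cases hx : x ∈ N
      · simpa [hx] using continuous_const
      · simpa [hx, Function.comp_def] using
          (hgood x hx).comp_continuous continuous_abs fun t => abs_nonneg t
    · exact fun t => Measurable.ite hN measurable_const (hmeas _ (abs_nonneg t))
  refine (hΨ.comp_aemeasurable (hw.prodMk aemeasurable_id)).congr ?_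
  filter_upwards [measure_eq_zero_iff_ae_notMem.1 hN0] with x hx
  simp [hx]

theorem mmodular_div_le_one_of_luxNorm_lt (hΦ : ∀ᵐ x ∂μ, IsDoublingYoung ℓ (Φ x)) {u : α → ℝ}
    (hu : MemLPhi μ Φ u) {K : ℝ} (hK : luxNorm μ Φ u < K) :
    mmodular μ Φ (fun x => u x / K) ≤ 1 := by
  have hne : {lam : ℝ | 0 < lam ∧ mmodular μ Φ (fun x => u x / lam) ≤ 1}.Nonempty := by
    obtain ⟨-, lam, hlam, hfin⟩ := hu
    set R := (mmodular μ Φ fun x => lam * u x).toReal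
    have hR : 0 ≤ R := ENNReal.toReal_nonneg
    refine ⟨(R + 1) / lam, by positivity, ?_⟩
    have hc0 : 0 ≤ (R + 1)⁻¹ := by positivity
    have hc1 : (R + 1)⁻¹ ≤ 1 := inv_le_one_of_one_le₀ (by linarith)
    calc mmodular μ Φ (fun x => u x / ((R + 1) / lam))
        ≤ ∫⁻ x, ENNReal.ofReal (R + 1)⁻¹ * ENNReal.ofReal (Φ x |lam * u x|) ∂μ := by
          refine lintegral_mono_ae ?_
          filter_upwards [hΦ] with x hx
          rw [← ENNReal.ofReal_mul hc0]
          refine ENNReal.ofReal_le_ofReal ?_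
          have h := hx.map_mul_le_self hc0 hc1 (abs_nonneg (lam * u x))
          rwa [← abs_of_nonneg hc0, ← abs_mul, abs_of_nonneg hc0,
            show (R + 1)⁻¹ * (lam * u x) = u x / ((R + 1) / lam) by field_simp] at h
      _ = ENNReal.ofReal (R + 1)⁻¹ * ENNReal.ofReal R := by
          rw [lintegral_const_mul' _ _ ENNReal.ofReal_ne_top, ENNReal.ofReal_toReal hfin.ne]
          rfl
      _ ≤ 1 := by
          rw [← ENNReal.ofReal_mul hc0, ENNReal.ofReal_le_one, inv_mul_le_iff₀ (by positivity)]
          linarith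
  obtain ⟨lam, ⟨hlam, hle⟩, hlt⟩ := exists_lt_of_csInf_lt hne hK
  refine le_trans (lintegral_mono_ae ?_) hle
  filter_upwards [hΦ] with x hx
  refine ENNReal.ofReal_le_ofReal (hx.mono (abs_nonneg _) ?_)
  rw [abs_div, abs_div, abs_of_pos hlam, abs_of_pos (hlam.trans hlt)]
  gcongr

theorem mmodular_le_of_mmodular_div_le_one (hΦ : ∀ᵐ x ∂μ, IsDoublingYoung ℓ (Φ x)) {u : α → ℝ}
    {K : ℝ} (hK : 1 ≤ K) (hu : mmodular μ Φ (fun x => u x / K) ≤ 1) :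
    mmodular μ Φ u ≤ ENNReal.ofReal (K ^ ℓ) := by
  have hK0 : 0 < K := by linarith
  calc mmodular μ Φ u
      ≤ ∫⁻ x, ENNReal.ofReal (K ^ ℓ) * ENNReal.ofReal (Φ x |u x / K|) ∂μ := by
        refine lintegral_mono_ae ?_
        filter_upwards [hΦ] with x hx
        rw [← ENNReal.ofReal_mul (by positivity)]
        refine ENNReal.ofReal_le_ofReal ?_
        have h := hx.map_mul_le K |u x / K| hK (abs_nonneg _)
        rw [abs_div, abs_of_pos hK0] at h ⊢
        rwa [mul_div_cancel₀ _ hK0.ne'] at h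
    _ = ENNReal.ofReal (K ^ ℓ) * mmodular μ Φ (fun x => u x / K) :=
        lintegral_const_mul' _ _ ENNReal.ofReal_ne_top
    _ ≤ ENNReal.ofReal (K ^ ℓ) := mul_le_of_le_one_right' hu

/-- Fatou's lemma for the modular. -/
theorem mmodular_le_of_tendsto_ae (hmeas : ∀ t : ℝ, 0 ≤ t → Measurable fun x => Φ x t)
    (hcont : ∀ᵐ x ∂μ, ContinuousOn (Φ x) (Set.Ici (0 : ℝ))) {u : ℕ → α → ℝ} {v : α → ℝ}
    (hu : ∀ n, AEMeasurable (u n) μ)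
    (hlim : ∀ᵐ x ∂μ, Tendsto (fun n => u n x) atTop (𝓝 (v x))) {M : ENNReal}
    (hM : ∀ n, mmodular μ Φ (u n) ≤ M) : mmodular μ Φ v ≤ M := by
  calc mmodular μ Φ v
      = ∫⁻ x, liminf (fun n => ENNReal.ofReal (Φ x |u n x|)) atTop ∂μ := by
        refine lintegral_congr_ae ?_
        filter_upwards [hcont, hlim] with x hx hxl
        exact (ENNReal.tendsto_ofReal (tendsto_comp_abs hx hxl)).liminf_eq.symm
    _ ≤ liminf (fun n => mmodular μ Φ (u n)) atTop :=
        lintegral_liminf_le' fun n => (aemeasurable_comp_abs hmeas hcont (hu n)).ennreal_ofReal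
    _ ≤ M := liminf_le_of_le (by isBoundedDefault) fun b hb => by
        obtain ⟨n, hn⟩ := hb.exists
        exact hn.trans (hM n)

/-- Boundedness of the modular passes to translates by a function of finite modular. -/
theorem exists_mmodular_sub_le (hmeas : ∀ t : ℝ, 0 ≤ t → Measurable fun x => Φ x t)
    (hcont : ∀ᵐ x ∂μ, ContinuousOn (Φ x) (Set.Ici (0 : ℝ)))
    (hΦ : ∀ᵐ x ∂μ, IsDoublingYoung ℓ (Φ x)) {u : ℕ → α → ℝ} {v : α → ℝ}
    (hv : AEMeasurable v μ) {M : ℝ} (hM : 0 ≤ M)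
    (huM : ∀ n, mmodular μ Φ (u n) ≤ ENNReal.ofReal M)
    (hvM : mmodular μ Φ v ≤ ENNReal.ofReal M) :
    ∃ B : ℝ, 0 ≤ B ∧ ∀ n, mmodular μ Φ (fun x => u n x - v x) ≤ ENNReal.ofReal B := by
  obtain ⟨C, hC, h⟩ := exists_forall_map_add_le ℓ zero_lt_one
  refine ⟨(1 + 1) * M + C * M, by positivity, fun n => ?_⟩
  have hvm := (aemeasurable_comp_abs hmeas hcont hv).ennreal_ofReal
  calc mmodular μ Φ (fun x => u n x - v x)
      ≤ ∫⁻ x, (ENNReal.ofReal (1 + 1) * ENNReal.ofReal (Φ x |u n x|)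
          + ENNReal.ofReal C * ENNReal.ofReal (Φ x |v x|)) ∂μ := by
        refine lintegral_mono_ae ?_
        filter_upwards [hΦ] with x hx
        have h1 := hx.nonneg _ (abs_nonneg (u n x))
        have h2 := hx.nonneg _ (abs_nonneg (v x))
        rw [← ENNReal.ofReal_mul (by norm_num), ← ENNReal.ofReal_mul hC,
          ← ENNReal.ofReal_add (by positivity) (by positivity)]
        exact ENNReal.ofReal_le_ofReal ((hx.mono (abs_nonneg _) (abs_sub _ _)).trans
          (h _ hx _ _ (abs_nonneg _) (abs_nonneg _)))
    _ = ENNReal.ofReal (1 + 1) * mmodular μ Φ (u n) + ENNReal.ofReal C * mmodular μ Φ v := by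
        rw [lintegral_add_right' _ (hvm.const_mul _),
          lintegral_const_mul' _ _ ENNReal.ofReal_ne_top,
          lintegral_const_mul' _ _ ENNReal.ofReal_ne_top]
        rfl
    _ ≤ ENNReal.ofReal (1 + 1) * ENNReal.ofReal M + ENNReal.ofReal C * ENNReal.ofReal M := by
        gcongr
        exact huM n
    _ = _ := by
        rw [← ENNReal.ofReal_mul (by norm_num), ← ENNReal.ofReal_mul hC,
          ← ENNReal.ofReal_add (by positivity) (by positivity)]

/-- The Brezis–Lieb splitting for sequences of bounded modular. -/
theorem tendsto_lintegral_abs_sub_sub (hmeas : ∀ t : ℝ, 0 ≤ t → Measurable fun x => Φ x t)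
    (hcont : ∀ᵐ x ∂μ, ContinuousOn (Φ x) (Set.Ici (0 : ℝ)))
    (hΦ : ∀ᵐ x ∂μ, IsDoublingYoung ℓ (Φ x)) {u : ℕ → α → ℝ} {v : α → ℝ}
    (hu : ∀ n, AEMeasurable (u n) μ) (hv : AEMeasurable v μ)
    (hlim : ∀ᵐ x ∂μ, Tendsto (fun n => u n x) atTop (𝓝 (v x)))
    (hvfin : mmodular μ Φ v ≠ ⊤) {B : ℝ} (hB : 0 ≤ B)
    (huB : ∀ n, mmodular μ Φ (fun x => u n x - v x) ≤ ENNReal.ofReal B) :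
    Tendsto
      (fun n => ∫⁻ x, ENNReal.ofReal (abs (Φ x |u n x| - Φ x |u n x - v x| - Φ x |v x|)) ∂μ)
      atTop (𝓝 0) := by
  have hmv := aemeasurable_comp_abs hmeas hcont hv
  have hmu := fun n => aemeasurable_comp_abs hmeas hcont (hu n)
  have hmd : ∀ n, AEMeasurable (fun x => Φ x |u n x - v x|) μ :=
    fun n => aemeasurable_comp_abs hmeas hcont ((hu n).sub hv)
  rw [ENNReal.tendsto_nhds_zero]
  intro η hη
  obtain ⟨r, hr0, hrη⟩ := ENNReal.lt_iff_exists_nnreal_btwn.1 hη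
  have hr : (0 : ℝ) < r := by exact_mod_cast hr0
  set ε : ℝ := min 1 (r / (4 * (B + 1)))
  have hε : 0 < ε := lt_min one_pos (by positivity)
  have hεB : 2 * ε * B ≤ r / 2 := by
    have h1 : ε * (4 * (B + 1)) ≤ r := (le_div_iff₀ (by positivity)).1 (min_le_right _ _)
    nlinarith
  obtain ⟨C, hC, hbl⟩ := exists_forall_abs_sub_sub_le ℓ hε (min_le_left _ _)
  set W : ℕ → α → ENNReal := fun n x => ENNReal.ofReal
    (abs (Φ x |u n x| - Φ x |u n x - v x| - Φ x |v x|) - 2 * ε * Φ x |u n x - v x|)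
  have hW : Tendsto (fun n => ∫⁻ x, W n x ∂μ) atTop (𝓝 0) := by
    have h := tendsto_lintegral_of_dominated_convergence' (μ := μ) (F := W) (f := fun _ => 0)
      (fun x => ENNReal.ofReal C * ENNReal.ofReal (Φ x |v x|))
      (fun n => (((((hmu n).sub (hmd n)).sub hmv).norm).sub
        ((hmd n).const_mul (2 * ε))).ennreal_ofReal) ?_ ?_ ?_
    · simpa using h
    · intro n
      filter_upwards [hΦ] with x hx
      rw [← ENNReal.ofReal_mul hC]
      refine ENNReal.ofReal_le_ofReal ?_
      linarith [hbl _ hx (u n x) (v x)]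
    · rw [lintegral_const_mul' _ _ ENNReal.ofReal_ne_top]
      exact ENNReal.mul_ne_top ENNReal.ofReal_ne_top hvfin
    · filter_upwards [hΦ, hcont, hlim] with x hx hxc hxl
      have h1 := tendsto_comp_abs hxc hxl
      have h2 := tendsto_comp_abs hxc (hxl.sub_const (v x))
      have h3 := ENNReal.tendsto_ofReal
        ((((h1.sub h2).sub_const (Φ x |v x|)).abs).sub (h2.const_mul (2 * ε)))
      simpa [hx.map_zero] using h3
  have hr2 : (0 : ENNReal) < ENNReal.ofReal (r / 2) := ENNReal.ofReal_pos.2 (by positivity)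
  filter_upwards [hW.eventually_le_const hr2] with n hn
  calc ∫⁻ x, ENNReal.ofReal (abs (Φ x |u n x| - Φ x |u n x - v x| - Φ x |v x|)) ∂μ
      ≤ ∫⁻ x, (W n x + ENNReal.ofReal (2 * ε) * ENNReal.ofReal (Φ x |u n x - v x|)) ∂μ := by
        refine lintegral_mono fun x => ?_
        rw [← ENNReal.ofReal_mul (by positivity)]
        refine le_trans (ENNReal.ofReal_le_ofReal ?_) ENNReal.ofReal_add_le
        linarith
    _ = ∫⁻ x, W n x ∂μ + ENNReal.ofReal (2 * ε) * mmodular μ Φ (fun x => u n x - v x) := by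
        rw [lintegral_add_right' _ ((hmd n).ennreal_ofReal.const_mul _),
          lintegral_const_mul' _ _ ENNReal.ofReal_ne_top]
        rfl
    _ ≤ ENNReal.ofReal (r / 2) + ENNReal.ofReal (2 * ε) * ENNReal.ofReal B := by
        gcongr
        exact huB n
    _ ≤ ENNReal.ofReal (r / 2) + ENNReal.ofReal (r / 2) := by
        rw [← ENNReal.ofReal_mul (by positivity)]
        gcongr
    _ = r := by
        rw [← ENNReal.ofReal_add (by positivity) (by positivity), add_halves,
          ENNReal.ofReal_coe_nnreal]
    _ ≤ η := hrη.le

end Modular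

/-- **Brezis–Lieb lemma in Musielak–Orlicz spaces.** Let `Φ` be a
generalized Young function satisfying the elasticity condition (D22) with constants
`1 < m ≤ ℓ < ∞` on a σ-finite measure space. If `{u_n}` is a sequence in `L^Φ_μ(Ω)`
with `sup_n ‖u_n‖_{L^Φ_μ} < ∞` and `u_n → u` μ-a.e., then `u ∈ L^Φ_μ(Ω)` and
`∫_Ω |Φ(x,|u_n|) − Φ(x,|u_n − u|) − Φ(x,|u|)| dμ → 0`. -/
theorem stmt9
    {α : Type*} [MeasurableSpace α] (μ : Measure α) [SigmaFinite μ]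
    (Φ φ : α → ℝ → ℝ) (m ℓ : ℝ)
    -- Φ is a generalized Young function
    (hmeas : ∀ t : ℝ, 0 ≤ t → Measurable fun x => Φ x t)
    (hnonneg : ∀ x, ∀ t : ℝ, 0 ≤ t → 0 ≤ Φ x t)
    (hyoung : ∀ᵐ x ∂μ,
      ConvexOn ℝ (Set.Ici (0 : ℝ)) (Φ x) ∧ ContinuousOn (Φ x) (Set.Ici (0 : ℝ)) ∧
        Φ x 0 = 0 ∧ (∃ t : ℝ, 0 ≤ t ∧ Φ x t ≠ 0))
    -- elasticity condition (D22) with constants 1 < m ≤ ℓ < ∞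
    (h1m : 1 < m) (hmℓ : m ≤ ℓ)
    (hD22 : ∀ᵐ x ∂μ,
      (∀ t : ℝ, 0 < t → HasDerivAt (Φ x) (φ x t) t) ∧
      (∀ t : ℝ, 0 < t → 0 < Φ x t) ∧
      (∀ t : ℝ, 0 < t → m ≤ t * φ x t / Φ x t ∧ t * φ x t / Φ x t ≤ ℓ))
    -- {u_n} bounded in L^Φ_μ(Ω), converging a.e. to u
    (u : ℕ → α → ℝ) (v : α → ℝ)
    (hun : ∀ n, MemLPhi μ Φ (u n))
    (hbdd : BddAbove (Set.range fun n => luxNorm μ Φ (u n)))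
    (haecv : ∀ᵐ x ∂μ, Tendsto (fun n => u n x) atTop (𝓝 (v x))) :
    MemLPhi μ Φ v ∧
      Tendsto
        (fun n => ∫⁻ x, ENNReal.ofReal (abs (Φ x |u n x| - Φ x |u n x - v x| - Φ x |v x|)) ∂μ)
        atTop (𝓝 0) := by
  have hcont : ∀ᵐ x ∂μ, ContinuousOn (Φ x) (Set.Ici (0 : ℝ)) := hyoung.mono fun x hx => hx.2.1
  have hΦ : ∀ᵐ x ∂μ, IsDoublingYoung ℓ (Φ x) := by
    filter_upwards [hyoung, hD22] with x hy hd
    exact ⟨hy.1, hnonneg x, hy.2.2.1, fun k t hk ht =>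
      map_mul_le_rpow_of_elasticity_le hy.2.2.1 hd.1 hd.2.1 (fun s hs => (hd.2.2 s hs).2) hk ht⟩
  have hv : AEMeasurable v μ := aemeasurable_of_tendsto_metrizable_ae' (fun n => (hun n).1) haecv
  obtain ⟨K₀, hK₀⟩ := hbdd
  set K : ℝ := max 1 (K₀ + 1)
  have hK : 1 ≤ K := le_max_left _ _
  have huK : ∀ n, mmodular μ Φ (u n) ≤ ENNReal.ofReal (K ^ ℓ) := fun n =>
    mmodular_le_of_mmodular_div_le_one hΦ hK (mmodular_div_le_one_of_luxNorm_lt hΦ (hun n)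
      ((lt_add_of_le_of_pos (hK₀ ⟨n, rfl⟩) one_pos).trans_le (le_max_right _ _)))
  have hvK := mmodular_le_of_tendsto_ae hmeas hcont (fun n => (hun n).1) haecv huK
  have hvfin : mmodular μ Φ v < ⊤ := hvK.trans_lt ENNReal.ofReal_lt_top
  obtain ⟨B, hB, huB⟩ := exists_mmodular_sub_le hmeas hcont hΦ hv (by positivity) huK hvK
  exact ⟨⟨hv, 1, one_pos, by simpa using hvfin⟩,
    tendsto_lintegral_abs_sub_sub hmeas hcont hΦ (fun n => (hun n).1) hv haecv hvfin.ne hB huB⟩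
end

section
/- Let d ≥ 2 be an integer and let Φ be a Young function satisfying the elasticity condition with constants 1 < m ≤ ℓ < d. Define N : [0,∞) → [0,∞) by N(t) = (∫₀ᵗ (τ/Φ(τ))^{1/(d−1)} dτ)^{(d−1)/d}. Then N(t) is finite for every t ≥ 0, N is strictly increasing and concave on [0,∞), and its inverse function N⁻¹ is convex. -/
open Set MeasureTheory

/-- The upper elasticity bound makes `Φ t / t ^ ℓ` nonincreasing. -/
theorem antitoneOn_mul_rpow_neg {Φ φ : ℝ → ℝ} {ℓ : ℝ}
    (hderiv : ∀ t : ℝ, 0 < t → HasDerivAt Φ (φ t) t) (hpos : ∀ t : ℝ, 0 < t → 0 < Φ t)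
    (helast : ∀ t : ℝ, 0 < t → t * φ t / Φ t ≤ ℓ) :
    AntitoneOn (fun t => Φ t * t ^ (-ℓ)) (Ioi 0) := by
  have hd : ∀ t : ℝ, 0 < t → HasDerivAt (fun t => Φ t * t ^ (-ℓ))
      (φ t * t ^ (-ℓ) + Φ t * (-ℓ * t ^ (-ℓ - 1))) t := fun t ht =>
    (hderiv t ht).mul (Real.hasDerivAt_rpow_const (Or.inl ht.ne'))
  refine antitoneOn_of_deriv_nonpos (convex_Ioi 0)
    (fun t ht => (hd t ht).continuousAt.continuousWithinAt) ?_ ?_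
  · rw [interior_Ioi]
    exact fun t ht => (hd t ht).differentiableAt.differentiableWithinAt
  · rw [interior_Ioi]
    intro t ht
    have ht : 0 < t := ht
    rw [(hd t ht).deriv]
    have h1 : t ^ (-ℓ) = t ^ (-ℓ - 1) * t := by
      rw [Real.rpow_sub_one ht.ne', div_mul_cancel₀ _ ht.ne']
    have h2 := (div_le_iff₀ (hpos t ht)).1 (helast t ht)
    rw [h1]
    nlinarith [Real.rpow_pos_of_pos ht (-ℓ - 1)]

/-- For a convex function `Φ` vanishing at `0` and positive on `(0, ∞)`, the quotient `t / Φ t` is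
nonincreasing. -/
theorem ConvexOn.antitoneOn_id_div {Φ : ℝ → ℝ} (hconv : ConvexOn ℝ (Ici (0 : ℝ)) Φ)
    (hΦ0 : Φ 0 = 0) (hpos : ∀ t : ℝ, 0 < t → 0 < Φ t) :
    AntitoneOn (fun t => t / Φ t) (Ioi 0) := by
  intro a ha b hb hab
  have ha : 0 < a := ha
  have hb : 0 < b := hb
  have h := hconv.2 (mem_Ici.2 le_rfl) (mem_Ici.2 hb.le)
    (sub_nonneg.2 ((div_le_one hb).2 hab)) (div_pos ha hb).le (by ring)
  simp only [smul_eq_mul, mul_zero, zero_add, hΦ0, div_mul_cancel₀ a hb.ne'] at h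
  change b / Φ b ≤ a / Φ a
  rw [div_le_div_iff₀ (hpos b hb) (hpos a ha)]
  calc b * Φ a ≤ b * (a / b * Φ b) := by gcongr
    _ = a * Φ b := by field_simp

theorem integrableOn_id_div_rpow {Φ : ℝ → ℝ} {ℓ p T : ℝ} (hp : 0 ≤ p) (hℓ : -1 < (1 - ℓ) * p)
    (hcont : ContinuousOn (fun τ => (τ / Φ τ) ^ p) (Ioi 0)) (hpos : ∀ t : ℝ, 0 < t → 0 < Φ t)
    (hanti : AntitoneOn (fun t => Φ t * t ^ (-ℓ)) (Ioi 0)) (hT : 0 ≤ T) :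
    IntegrableOn (fun τ => (τ / Φ τ) ^ p) (Ioc 0 T) := by
  rcases hT.eq_or_lt with rfl | hT
  · simp
  have hint : IntegrableOn (fun τ : ℝ => ((Φ T * T ^ (-ℓ))⁻¹) ^ p * τ ^ ((1 - ℓ) * p)) (Ioc 0 T) :=
    ((intervalIntegrable_iff_integrableOn_Ioc_of_le hT.le).1
      (intervalIntegral.intervalIntegrable_rpow' hℓ)).const_mul _
  refine Integrable.mono' hint
    ((hcont.mono Ioc_subset_Ioi_self).aestronglyMeasurable measurableSet_Ioc) ?_
  refine (ae_restrict_mem measurableSet_Ioc).mono fun τ hτ => ?_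
  have hτ0 : 0 < τ := hτ.1
  have hK : 0 < Φ T * T ^ (-ℓ) := mul_pos (hpos T hT) (Real.rpow_pos_of_pos hT _)
  have hq : 0 < τ / Φ τ := div_pos hτ0 (hpos τ hτ0)
  rw [Real.norm_of_nonneg (Real.rpow_nonneg hq.le _), Real.rpow_mul hτ0.le,
    ← Real.mul_rpow (inv_nonneg.2 hK.le) (Real.rpow_nonneg hτ0.le _)]
  refine Real.rpow_le_rpow hq.le ?_ hp
  have h : Φ T * T ^ (-ℓ) ≤ Φ τ * τ ^ (-ℓ) := hanti hτ0 hT hτ.2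
  have h1 : τ ^ (1 - ℓ) = τ * τ ^ (-ℓ) := by
    rw [sub_eq_add_neg, Real.rpow_add hτ0, Real.rpow_one]
  rw [h1, inv_mul_eq_div, div_le_div_iff₀ (hpos τ hτ0) hK]
  calc τ * (Φ T * T ^ (-ℓ)) ≤ τ * (Φ τ * τ ^ (-ℓ)) := by gcongr
    _ = τ * τ ^ (-ℓ) * Φ τ := by ring

theorem hasDerivAt_setIntegral_Ioc {f : ℝ → ℝ} (hcont : ContinuousOn f (Ioi 0))
    (hint : ∀ t : ℝ, 0 ≤ t → IntegrableOn f (Ioc 0 t)) {t : ℝ} (ht : 0 < t) :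
    HasDerivAt (fun t => ∫ τ in Ioc 0 t, f τ) (f t) t := by
  have h := intervalIntegral.integral_hasDerivAt_right
    ((intervalIntegrable_iff_integrableOn_Ioc_of_le ht.le).2 (hint t ht.le))
    (hcont.stronglyMeasurableAtFilter isOpen_Ioi t ht)
    (hcont.continuousAt (Ioi_mem_nhds ht))
  refine h.congr_of_eventuallyEq ?_
  filter_upwards [Ioi_mem_nhds ht] with s hs
  exact (intervalIntegral.integral_of_le (le_of_lt hs)).symm

theorem continuousOn_setIntegral_Ioc {f : ℝ → ℝ}
    (hint : ∀ t : ℝ, 0 ≤ t → IntegrableOn f (Ioc 0 t)) :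
    ContinuousOn (fun t => ∫ τ in Ioc 0 t, f τ) (Ici 0) := by
  intro t ht
  have ht : 0 ≤ t := ht
  have h := intervalIntegral.continuousOn_primitive
    ((integrableOn_Icc_iff_integrableOn_Ioc (by simp)).2 (hint (t + 1) (by linarith)))
  refine (h t ⟨ht, by linarith⟩).mono_of_mem_nhdsWithin ?_
  rw [← Ici_inter_Iic]
  exact Filter.inter_mem self_mem_nhdsWithin (mem_nhdsWithin_of_mem_nhds (Iic_mem_nhds (by linarith)))

theorem strictMonoOn_setIntegral_Ioc {f : ℝ → ℝ} (hcont : ContinuousOn f (Ioi 0))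
    (hint : ∀ t : ℝ, 0 ≤ t → IntegrableOn f (Ioc 0 t)) (hpos : ∀ t : ℝ, 0 < t → 0 < f t) :
    StrictMonoOn (fun t => ∫ τ in Ioc 0 t, f τ) (Ici 0) := by
  refine strictMonoOn_of_deriv_pos (convex_Ici 0) (continuousOn_setIntegral_Ioc hint) ?_
  rw [interior_Ici]
  intro t ht
  rw [(hasDerivAt_setIntegral_Ioc hcont hint ht).deriv]
  exact hpos t ht

theorem concaveOn_setIntegral_Ioc {f : ℝ → ℝ} (hcont : ContinuousOn f (Ioi 0))
    (hint : ∀ t : ℝ, 0 ≤ t → IntegrableOn f (Ioc 0 t)) (hanti : AntitoneOn f (Ioi 0)) :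
    ConcaveOn ℝ (Ici 0) (fun t => ∫ τ in Ioc 0 t, f τ) := by
  refine AntitoneOn.concaveOn_of_deriv (convex_Ici 0) (continuousOn_setIntegral_Ioc hint) ?_ ?_
  · rw [interior_Ici]
    exact fun t ht =>
      (hasDerivAt_setIntegral_Ioc hcont hint ht).differentiableAt.differentiableWithinAt
  · rw [interior_Ici]
    exact hanti.congr fun t ht => (hasDerivAt_setIntegral_Ioc hcont hint ht).deriv.symm

/-- The inverse of a continuous strictly increasing concave function on an interval is convex. -/
theorem ConcaveOn.convexOn_invFunOn {s : Set ℝ} {N : ℝ → ℝ} (hN : ConcaveOn ℝ s N)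
    (hmono : StrictMonoOn N s) (hcont : ContinuousOn N s) :
    ConvexOn ℝ (N '' s) (Function.invFunOn N s) := by
  have himg : Convex ℝ (N '' s) :=
    (hN.1.isPreconnected.image N hcont).ordConnected.convex
  refine ⟨himg, ?_⟩
  intro x hx y hy a b ha hb hab
  have hz := himg hx hy ha hb hab
  refine (hmono.le_iff_le (Function.invFunOn_mem hz)
    (hN.1 (Function.invFunOn_mem hx) (Function.invFunOn_mem hy) ha hb hab)).1 ?_
  have h := hN.2 (Function.invFunOn_mem hx) (Function.invFunOn_mem hy) ha hb hab
  rwa [Function.invFunOn_eq hx, Function.invFunOn_eq hy, ← Function.invFunOn_eq hz] at h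

/-- Let `d ≥ 2` and let `Φ` be a Young function satisfying the
elasticity condition with constants `1 < m ≤ ℓ < d`. Then
`N(t) = (∫₀ᵗ (τ/Φ(τ))^{1/(d−1)} dτ)^{(d−1)/d}` is finite for every `t ≥ 0` (i.e. the
integrand is integrable on `(0,t]`), `N` is strictly increasing and concave on
`[0,∞)`, and its inverse function is convex. -/
theorem stmt10
    (d : ℕ) (hd : 2 ≤ d)
    (Φ φ : ℝ → ℝ) (m ℓ : ℝ)
    -- Φ is a Young function
    (hconv : ConvexOn ℝ (Set.Ici (0 : ℝ)) Φ)
    (hcont : ContinuousOn Φ (Set.Ici (0 : ℝ)))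
    (hΦ0 : Φ 0 = 0)
    (hnonneg : ∀ t : ℝ, 0 ≤ t → 0 ≤ Φ t)
    (hnonconst : ∃ t : ℝ, 0 ≤ t ∧ Φ t ≠ 0)
    -- elasticity condition with constants 1 < m ≤ ℓ < d
    (h1m : 1 < m) (hmℓ : m ≤ ℓ) (hℓd : ℓ < d)
    (hderiv : ∀ t : ℝ, 0 < t → HasDerivAt Φ (φ t) t)
    (hpos : ∀ t : ℝ, 0 < t → 0 < Φ t)
    (helast : ∀ t : ℝ, 0 < t → m ≤ t * φ t / Φ t ∧ t * φ t / Φ t ≤ ℓ)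
    -- the function N
    (N : ℝ → ℝ)
    (hN : ∀ t : ℝ, N t =
      (∫ τ in Set.Ioc (0 : ℝ) t, (τ / Φ τ) ^ ((1 : ℝ) / ((d : ℝ) - 1))) ^
        (((d : ℝ) - 1) / (d : ℝ))) :
    (∀ t : ℝ, 0 ≤ t →
        IntegrableOn (fun τ => (τ / Φ τ) ^ ((1 : ℝ) / ((d : ℝ) - 1))) (Set.Ioc 0 t)) ∧
      StrictMonoOn N (Set.Ici (0 : ℝ)) ∧
      ConcaveOn ℝ (Set.Ici (0 : ℝ)) N ∧
      ConvexOn ℝ (N '' Set.Ici (0 : ℝ)) (Function.invFunOn N (Set.Ici (0 : ℝ))) := by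
  have hd2 : (2 : ℝ) ≤ d := by exact_mod_cast hd
  have hd1 : (0 : ℝ) < (d : ℝ) - 1 := by linarith
  have hd0 : (0 : ℝ) < d := by linarith
  set p : ℝ := (1 : ℝ) / ((d : ℝ) - 1) with hp
  have hp0 : 0 < p := one_div_pos.2 hd1
  have hq0 : 0 < ((d : ℝ) - 1) / d := div_pos hd1 hd0
  have hq1 : ((d : ℝ) - 1) / d ≤ 1 := (div_le_one hd0).2 (by linarith)
  have hquot : ∀ t : ℝ, 0 < t → 0 < t / Φ t := fun t ht => div_pos ht (hpos t ht)
  have hfcont : ContinuousOn (fun τ => (τ / Φ τ) ^ p) (Ioi 0) :=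
    (continuousOn_id.div (hcont.mono Ioi_subset_Ici_self) fun t ht => (hpos t ht).ne').rpow_const
      fun _ _ => Or.inr hp0.le
  have hfanti : AntitoneOn (fun τ => (τ / Φ τ) ^ p) (Ioi 0) := fun a ha b hb hab =>
    Real.rpow_le_rpow (hquot b hb).le (hconv.antitoneOn_id_div hΦ0 hpos ha hb hab) hp0.le
  have hexp : -1 < (1 - ℓ) * p := by
    rw [hp, mul_one_div, lt_div_iff₀ hd1]
    linarith
  have hint : ∀ t : ℝ, 0 ≤ t → IntegrableOn (fun τ => (τ / Φ τ) ^ p) (Ioc 0 t) := fun t ht =>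
    integrableOn_id_div_rpow hp0.le hexp hfcont hpos
      (antitoneOn_mul_rpow_neg hderiv hpos fun t ht => (helast t ht).2) ht
  have hFmono := strictMonoOn_setIntegral_Ioc hfcont hint
    fun t ht => Real.rpow_pos_of_pos (hquot t ht) p
  have hFconc := concaveOn_setIntegral_Ioc hfcont hint hfanti
  have hFnonneg : ∀ t : ℝ, 0 ≤ ∫ τ in Ioc 0 t, (τ / Φ τ) ^ p := fun t =>
    setIntegral_nonneg measurableSet_Ioc fun τ hτ => Real.rpow_nonneg (hquot τ hτ.1).le p
  have hNmono : StrictMonoOn N (Ici 0) := fun a ha b hb hab => by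
    rw [hN a, hN b]
    exact Real.rpow_lt_rpow (hFnonneg a) (hFmono ha hb hab) hq0
  have hNcont : ContinuousOn N (Ici 0) :=
    ((continuousOn_setIntegral_Ioc hint).rpow_const fun _ _ => Or.inr hq0.le).congr
      fun t _ => hN t
  have hNconc : ConcaveOn ℝ (Ici 0) N := by
    refine ⟨convex_Ici 0, fun x hx y hy a b ha hb hab => ?_⟩
    rw [hN x, hN y, hN (a • x + b • y)]
    refine ((Real.concaveOn_rpow hq0.le hq1).2 (hFnonneg x) (hFnonneg y) ha hb hab).trans ?_
    exact Real.rpow_le_rpow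
      (add_nonneg (mul_nonneg ha (hFnonneg x)) (mul_nonneg hb (hFnonneg y)))
      (hFconc.2 hx hy ha hb hab) hq0.le
  exact ⟨hint, hNmono, hNconc, hNconc.convexOn_invFunOn hNmono hNcont⟩
end

section
/- Let d ≥ 2 be an integer and let Φ be a Young function satisfying the elasticity condition with constants 1 < m ≤ ℓ < d. Define N(t) = (∫₀ᵗ (τ/Φ(τ))^{1/(d−1)} dτ)^{(d−1)/d}. Then for all t, ξ ≥ 0 one has min{t^{(d−m)/d}, t^{(d−ℓ)/d}}·N(ξ) ≤ N(tξ) ≤ max{t^{(d−m)/d}, t^{(d−ℓ)/d}}·N(ξ). -/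
open Set MeasureTheory

/-- A function with lower elasticity bound `m` has `Φ a ≤ (a / b) ^ m * Φ b` for `a ≤ b`. -/
lemma le_div_rpow_mul_of_elasticity_ge {Φ φ : ℝ → ℝ} {m : ℝ}
    (hderiv : ∀ t : ℝ, 0 < t → HasDerivAt Φ (φ t) t)
    (h : ∀ t : ℝ, 0 < t → m * Φ t ≤ t * φ t) {a b : ℝ} (ha : 0 < a) (hab : a ≤ b) :
    Φ a ≤ (a / b) ^ m * Φ b := by
  have hb : 0 < b := ha.trans_le hab
  have hd : ∀ t : ℝ, 0 < t →
      HasDerivAt (fun t => Φ t * t ^ (-m)) (φ t * t ^ (-m) + Φ t * (-m * t ^ (-m - 1))) t :=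
    fun t ht => (hderiv t ht).mul (Real.hasDerivAt_rpow_const (Or.inl ht.ne'))
  have hmono : MonotoneOn (fun t => Φ t * t ^ (-m)) (Ioi 0) := by
    refine monotoneOn_of_deriv_nonneg (convex_Ioi 0)
      (fun t ht => (hd t ht).continuousAt.continuousWithinAt)
      (fun t ht => (hd t (interior_subset ht)).differentiableAt.differentiableWithinAt) ?_
    intro t ht
    have ht : 0 < t := interior_subset ht
    rw [(hd t ht).deriv]
    have e : t ^ (-m) = t ^ (-m - 1) * t := by
      rw [← Real.rpow_add_one ht.ne', sub_add_cancel]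
    have := mul_nonneg (Real.rpow_pos_of_pos ht (-m - 1)).le (sub_nonneg.2 (h t ht))
    rw [e]
    linarith
  have key : Φ a * a ^ (-m) ≤ Φ b * b ^ (-m) := hmono ha hb hab
  rw [Real.rpow_neg ha.le, Real.rpow_neg hb.le, ← div_eq_mul_inv, ← div_eq_mul_inv,
    div_le_iff₀ (Real.rpow_pos_of_pos ha m)] at key
  rw [Real.div_rpow ha.le hb.le]
  exact key.trans_eq (by ring)

/-- A function with upper elasticity bound `l` has `(a / b) ^ l * Φ b ≤ Φ a` for `a ≤ b`. -/
lemma div_rpow_mul_le_of_elasticity_le {Φ φ : ℝ → ℝ} {l : ℝ}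
    (hderiv : ∀ t : ℝ, 0 < t → HasDerivAt Φ (φ t) t)
    (h : ∀ t : ℝ, 0 < t → t * φ t ≤ l * Φ t) {a b : ℝ} (ha : 0 < a) (hab : a ≤ b) :
    (a / b) ^ l * Φ b ≤ Φ a := by
  have := le_div_rpow_mul_of_elasticity_ge (Φ := fun t => -Φ t) (φ := fun t => -φ t) (m := l)
    (fun t ht => (hderiv t ht).neg) (fun t ht => by linarith [h t ht]) ha hab
  linarith

/-- If `Φ` is positive and grows at most like the power `l`, then `(τ / Φ τ) ^ p` is integrable
near `0` as soon as `(l - 1) * p < 1`. -/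
lemma integrableOn_div_rpow_Ioc {Φ : ℝ → ℝ} {l p x : ℝ} (hp : 0 ≤ p) (hlp : (l - 1) * p < 1)
    (hcont : ContinuousOn Φ (Ioi 0)) (hpos : ∀ t : ℝ, 0 < t → 0 < Φ t)
    (hlow : ∀ a b : ℝ, 0 < a → a ≤ b → (a / b) ^ l * Φ b ≤ Φ a) (hx : 0 < x) :
    IntegrableOn (fun τ => (τ / Φ τ) ^ p) (Ioc 0 x) := by
  have hg : ContinuousOn (fun τ => (τ / Φ τ) ^ p) (Ioc 0 x) := by
    have hc : ContinuousOn Φ (Ioc 0 x) := hcont.mono Ioc_subset_Ioi_self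
    exact (continuousOn_id.div hc fun t ht => (hpos t ht.1).ne').rpow_const fun _ _ => Or.inr hp
  have hint : IntegrableOn (fun τ : ℝ => (x ^ l / Φ x) ^ p * τ ^ ((1 - l) * p)) (Ioc 0 x) :=
    ((intervalIntegrable_iff_integrableOn_Ioc_of_le hx.le).1
      (intervalIntegral.intervalIntegrable_rpow' (by linarith))).const_mul _
  refine hint.mono' (hg.aestronglyMeasurable measurableSet_Ioc) ?_
  filter_upwards [ae_restrict_mem measurableSet_Ioc] with τ hτ
  have hτ0 : 0 < τ := hτ.1
  have hΦτ := hpos τ hτ0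
  have hΦx := hpos x hx
  have hxl := Real.rpow_pos_of_pos hx l
  have hτl := Real.rpow_pos_of_pos hτ0 l
  rw [Real.norm_of_nonneg (by positivity), Real.rpow_mul hτ0.le,
    ← Real.mul_rpow (by positivity) (by positivity)]
  refine Real.rpow_le_rpow (by positivity) ?_ hp
  have h := hlow τ x hτ0 hτ.2
  rw [Real.div_rpow hτ0.le hx.le] at h
  calc τ / Φ τ ≤ τ / (τ ^ l / x ^ l * Φ x) := by gcongr
    _ = x ^ l / Φ x * τ ^ (1 - l) := by
      rw [Real.rpow_sub hτ0, Real.rpow_one]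
      field_simp

/-- A pointwise bound `Φ (t * s) ≤ t ^ k * Φ s` bounds `∫₀^{tξ} (τ / Φ τ) ^ p` from below. -/
lemma rpow_mul_setIntegral_le {Φ : ℝ → ℝ} {p k t ξ : ℝ} (hp : 0 ≤ p)
    (hpos : ∀ t : ℝ, 0 < t → 0 < Φ t)
    (hint : ∀ x, 0 < x → IntegrableOn (fun τ => (τ / Φ τ) ^ p) (Ioc 0 x))
    (ht : 0 < t) (hξ : 0 < ξ) (h : ∀ s, 0 < s → Φ (t * s) ≤ t ^ k * Φ s) :
    t ^ (1 + (1 - k) * p) * ∫ τ in Ioc 0 ξ, (τ / Φ τ) ^ p ≤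
      ∫ τ in Ioc 0 (t * ξ), (τ / Φ τ) ^ p := by
  have htξ : 0 < t * ξ := mul_pos ht hξ
  have hi : IntervalIntegrable (fun s => (t * s / Φ (t * s)) ^ p) volume 0 ξ := by
    have := ((intervalIntegrable_iff_integrableOn_Ioc_of_le htξ.le).2
      (hint _ htξ)).comp_mul_left (c := t)
    simpa [ht.ne'] using this
  have hsub := intervalIntegral.mul_integral_comp_mul_left (a := 0) (b := ξ)
    (f := fun τ => (τ / Φ τ) ^ p) (c := t)
  rw [mul_zero] at hsub
  rw [← intervalIntegral.integral_of_le hξ.le, ← intervalIntegral.integral_of_le htξ.le, ← hsub,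
    Real.rpow_add ht, Real.rpow_one, mul_assoc]
  refine mul_le_mul_of_nonneg_left ?_ ht.le
  rw [← intervalIntegral.integral_const_mul, intervalIntegral.integral_of_le hξ.le,
    intervalIntegral.integral_of_le hξ.le]
  refine setIntegral_mono_on ((hint ξ hξ).const_mul _)
    ((intervalIntegrable_iff_integrableOn_Ioc_of_le hξ.le).1 hi) measurableSet_Ioc ?_
  intro s hs
  have hs0 : 0 < s := hs.1
  have hΦs := hpos s hs0
  have hΦts := hpos (t * s) (mul_pos ht hs0)
  have htk := Real.rpow_pos_of_pos ht k
  rw [Real.rpow_mul ht.le, ← Real.mul_rpow (by positivity) (by positivity)]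
  refine Real.rpow_le_rpow (by positivity) ?_ hp
  calc t ^ (1 - k) * (s / Φ s) = t * s / (t ^ k * Φ s) := by
        rw [Real.rpow_sub ht, Real.rpow_one]
        field_simp
    _ ≤ t * s / Φ (t * s) := by
      gcongr
      exact h s hs0

/-- Let `d ≥ 2` and let `Φ` be a Young function satisfying the
elasticity condition with constants `1 < m ≤ ℓ < d`, and let
`N(t) = (∫₀ᵗ (τ/Φ(τ))^{1/(d−1)} dτ)^{(d−1)/d}`. Then for all `t, ξ ≥ 0`,
`min (t^{(d−m)/d}) (t^{(d−ℓ)/d}) N(ξ) ≤ N(tξ) ≤ max (t^{(d−m)/d}) (t^{(d−ℓ)/d}) N(ξ)`. -/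
theorem stmt11
    (d : ℕ) (hd : 2 ≤ d)
    (Φ φ : ℝ → ℝ) (m ℓ : ℝ)
    -- Φ is a Young function
    (hconv : ConvexOn ℝ (Set.Ici (0 : ℝ)) Φ)
    (hcont : ContinuousOn Φ (Set.Ici (0 : ℝ)))
    (hΦ0 : Φ 0 = 0)
    (hnonneg : ∀ t : ℝ, 0 ≤ t → 0 ≤ Φ t)
    (hnonconst : ∃ t : ℝ, 0 ≤ t ∧ Φ t ≠ 0)
    -- elasticity condition with constants 1 < m ≤ ℓ < d
    (h1m : 1 < m) (hmℓ : m ≤ ℓ) (hℓd : ℓ < d)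
    (hderiv : ∀ t : ℝ, 0 < t → HasDerivAt Φ (φ t) t)
    (hpos : ∀ t : ℝ, 0 < t → 0 < Φ t)
    (helast : ∀ t : ℝ, 0 < t → m ≤ t * φ t / Φ t ∧ t * φ t / Φ t ≤ ℓ)
    -- the function N
    (N : ℝ → ℝ)
    (hN : ∀ t : ℝ, N t =
      (∫ τ in Set.Ioc (0 : ℝ) t, (τ / Φ τ) ^ ((1 : ℝ) / ((d : ℝ) - 1))) ^
        (((d : ℝ) - 1) / (d : ℝ))) :
    ∀ t ξ : ℝ, 0 ≤ t → 0 ≤ ξ →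
      min (t ^ (((d : ℝ) - m) / (d : ℝ))) (t ^ (((d : ℝ) - ℓ) / (d : ℝ))) * N ξ ≤ N (t * ξ) ∧
        N (t * ξ) ≤
          max (t ^ (((d : ℝ) - m) / (d : ℝ))) (t ^ (((d : ℝ) - ℓ) / (d : ℝ))) * N ξ := by
  have hd2 : (2 : ℝ) ≤ d := by exact_mod_cast hd
  have hd0 : (0 : ℝ) < d := by linarith
  have hd1 : (0 : ℝ) < (d : ℝ) - 1 := by linarith
  set p : ℝ := (1 : ℝ) / ((d : ℝ) - 1) with hpdef
  have hp : 0 ≤ p := by positivity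
  have hup : ∀ a b : ℝ, 0 < a → a ≤ b → Φ a ≤ (a / b) ^ m * Φ b := fun a b =>
    le_div_rpow_mul_of_elasticity_ge hderiv fun t ht =>
      (le_div_iff₀ (hpos t ht)).1 (helast t ht).1
  have hlow : ∀ a b : ℝ, 0 < a → a ≤ b → (a / b) ^ ℓ * Φ b ≤ Φ a := fun a b =>
    div_rpow_mul_le_of_elasticity_le hderiv fun t ht =>
      (div_le_iff₀ (hpos t ht)).1 (helast t ht).2
  have hint : ∀ x, 0 < x → IntegrableOn (fun τ => (τ / Φ τ) ^ p) (Ioc 0 x) := by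
    refine fun x => integrableOn_div_rpow_Ioc hp ?_ (hcont.mono Ioi_subset_Ici_self) hpos hlow
    rw [hpdef, mul_one_div, div_lt_one hd1]
    linarith
  have hI : ∀ x, 0 ≤ ∫ τ in Ioc (0 : ℝ) x, (τ / Φ τ) ^ p := fun x =>
    setIntegral_nonneg measurableSet_Ioc fun τ hτ =>
      Real.rpow_nonneg (div_nonneg hτ.1.le (hpos τ hτ.1).le) _
  have hN0 : N 0 = 0 := by
    rw [hN]
    simp [(div_pos hd1 hd0).ne']
  have hscale : ∀ k t ξ : ℝ, 0 < t → 0 < ξ → (∀ s, 0 < s → Φ (t * s) ≤ t ^ k * Φ s) →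
      t ^ (((d : ℝ) - k) / d) * N ξ ≤ N (t * ξ) := by
    intro k t ξ ht hξ h
    have e : ((d : ℝ) - k) / d = (1 + (1 - k) * p) * (((d : ℝ) - 1) / d) := by
      rw [hpdef]
      field_simp
      ring
    rw [hN, hN, e, Real.rpow_mul ht.le, ← Real.mul_rpow (Real.rpow_nonneg ht.le _) (hI ξ)]
    exact Real.rpow_le_rpow (mul_nonneg (Real.rpow_nonneg ht.le _) (hI ξ))
      (rpow_mul_setIntegral_le hp hpos hint ht hξ h) (div_nonneg hd1.le hd0.le)
  have hsmall : ∀ t ξ : ℝ, 0 < t → t ≤ 1 → 0 < ξ →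
      t ^ (((d : ℝ) - m) / d) * N ξ ≤ N (t * ξ) ∧
        N (t * ξ) ≤ t ^ (((d : ℝ) - ℓ) / d) * N ξ := by
    intro t ξ ht ht1 hξ
    refine ⟨hscale m t ξ ht hξ fun s hs => ?_, ?_⟩
    · have := hup (t * s) s (mul_pos ht hs) (mul_le_of_le_one_left hs.le ht1)
      rwa [mul_div_cancel_right₀ _ hs.ne'] at this
    · have := hscale ℓ t⁻¹ (t * ξ) (inv_pos.2 ht) (mul_pos ht hξ) fun s hs => by
        have := hlow s (t⁻¹ * s) hs (le_mul_of_one_le_left hs.le ((one_le_inv₀ ht).2 ht1))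
        have e : s / (t⁻¹ * s) = t := by field_simp
        rw [e] at this
        rwa [Real.inv_rpow ht.le, le_inv_mul_iff₀ (Real.rpow_pos_of_pos ht _)]
      rwa [inv_mul_cancel_left₀ ht.ne', Real.inv_rpow ht.le, ← div_eq_inv_mul,
        div_le_iff₀' (Real.rpow_pos_of_pos ht _)] at this
  intro t ξ ht hξ
  have hNξ : 0 ≤ N ξ := by
    rw [hN]
    exact Real.rpow_nonneg (hI ξ) _
  rcases hξ.eq_or_lt with rfl | hξ
  · simp [hN0]
  rcases ht.eq_or_lt with rfl | ht
  · rw [zero_mul, hN0, Real.zero_rpow (div_pos (by linarith) hd0).ne',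
      Real.zero_rpow (div_pos (by linarith) hd0).ne']
    simp
  rcases le_total t 1 with ht1 | ht1
  · obtain ⟨h₁, h₂⟩ := hsmall t ξ ht ht1 hξ
    exact ⟨(mul_le_mul_of_nonneg_right (min_le_left _ _) hNξ).trans h₁,
      h₂.trans (mul_le_mul_of_nonneg_right (le_max_right _ _) hNξ)⟩
  · obtain ⟨h₁, h₂⟩ := hsmall t⁻¹ (t * ξ) (inv_pos.2 ht) (inv_le_one_of_one_le₀ ht1)
      (mul_pos ht hξ)
    rw [inv_mul_cancel_left₀ ht.ne', Real.inv_rpow ht.le, ← div_eq_inv_mul] at h₁ h₂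
    rw [div_le_iff₀' (Real.rpow_pos_of_pos ht _)] at h₁
    rw [le_div_iff₀' (Real.rpow_pos_of_pos ht _)] at h₂
    exact ⟨(mul_le_mul_of_nonneg_right (min_le_right _ _) hNξ).trans h₂,
      h₁.trans (mul_le_mul_of_nonneg_right (le_max_left _ _) hNξ)⟩
end

section
/- Let d ≥ 2 be an integer and let Φ be a Young function satisfying the elasticity condition with constants 1 < m ≤ ℓ < d. Define N(t) = (∫₀ᵗ (τ/Φ(τ))^{1/(d−1)} dτ)^{(d−1)/d}. Then N is a strictly increasing bijection of [0,∞) onto itself and, setting Φ*(t) := Φ(N⁻¹(t)), m* := dm/(d−m) and ℓ* := dℓ/(d−ℓ), one has min{t^{m*}, t^{ℓ*}}·Φ*(ξ) ≤ Φ*(tξ) ≤ max{t^{m*}, t^{ℓ*}}·Φ*(ξ) for all t, ξ ≥ 0. -/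
open Set MeasureTheory

/-- If `a` bounds the elasticity of `Φ` from below, then `Φ` grows at least like the power `a`. -/
theorem rpow_mul_le_of_elasticity_ge {Φ φ : ℝ → ℝ} {a : ℝ}
    (hderiv : ∀ t : ℝ, 0 < t → HasDerivAt Φ (φ t) t)
    (h : ∀ t : ℝ, 0 < t → a * Φ t ≤ t * φ t) {c s : ℝ} (hc : 1 ≤ c) (hs : 0 < s) :
    c ^ a * Φ s ≤ Φ (c * s) := by
  have hd : ∀ x : ℝ, 0 < x → HasDerivAt (fun x => Φ x * x ^ (-a))
      (φ x * x ^ (-a) + Φ x * (-a * x ^ (-a - 1))) x := fun x hx =>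
    (hderiv x hx).mul (Real.hasDerivAt_rpow_const (Or.inl hx.ne'))
  have hmono : MonotoneOn (fun x => Φ x * x ^ (-a)) (Ioi 0) := by
    refine monotoneOn_of_deriv_nonneg (convex_Ioi 0)
      (fun x hx => (hd x hx).continuousAt.continuousWithinAt) ?_ ?_ <;> rw [interior_Ioi]
    · exact fun x hx => (hd x hx).differentiableAt.differentiableWithinAt
    · intro x hx
      have hx : 0 < x := hx
      rw [(hd x hx).deriv]
      have e : x ^ (-a) = x * x ^ (-a - 1) := by
        rw [Real.rpow_sub_one hx.ne']
        field_simp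
      rw [e]
      have := mul_nonneg (sub_nonneg.2 (h x hx)) (Real.rpow_nonneg hx.le (-a - 1))
      linarith
  have hc0 : 0 < c := by linarith
  have key : Φ s * s ^ (-a) ≤ Φ (c * s) * (c * s) ^ (-a) :=
    hmono hs (mul_pos hc0 hs) (le_mul_of_one_le_left hs.le hc)
  rw [Real.mul_rpow hc0.le hs.le, ← mul_assoc] at key
  have key' := le_of_mul_le_mul_right key (Real.rpow_pos_of_pos hs _)
  rw [Real.rpow_neg hc0.le, ← div_eq_mul_inv, le_div_iff₀ (Real.rpow_pos_of_pos hc0 _)] at key'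
  linarith

/-- If `a` bounds the elasticity of `Φ` from above, then `Φ` grows at most like the power `a`. -/
theorem le_rpow_mul_of_elasticity_le {Φ φ : ℝ → ℝ} {a : ℝ}
    (hderiv : ∀ t : ℝ, 0 < t → HasDerivAt Φ (φ t) t)
    (h : ∀ t : ℝ, 0 < t → t * φ t ≤ a * Φ t) {c s : ℝ} (hc : 1 ≤ c) (hs : 0 < s) :
    Φ (c * s) ≤ c ^ a * Φ s := by
  have := rpow_mul_le_of_elasticity_ge (Φ := fun t => -Φ t) (φ := fun t => -φ t) (a := a)
    (fun t ht => (hderiv t ht).neg) (fun t ht => by linarith [h t ht]) hc hs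
  simp only [mul_neg] at this
  linarith

/-- A lower power bound on the growth of `Φ` bounds the growth of `(τ / Φ τ) ^ p` from above. -/
theorem div_rpow_mul_le {Φ : ℝ → ℝ} {a p c s : ℝ} (hp : 0 ≤ p) (hc : 0 < c) (hs : 0 < s)
    (hΦs : 0 < Φ s) (h : c ^ a * Φ s ≤ Φ (c * s)) :
    (c * s / Φ (c * s)) ^ p ≤ c ^ ((1 - a) * p) * (s / Φ s) ^ p := by
  have hca := Real.rpow_pos_of_pos hc a
  rw [Real.rpow_mul hc.le, ← Real.mul_rpow (Real.rpow_nonneg hc.le _) (div_pos hs hΦs).le]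
  have hle : c * s / Φ (c * s) ≤ c * s / (c ^ a * Φ s) := by gcongr
  have hpos : 0 < Φ (c * s) := (mul_pos hca hΦs).trans_le h
  refine Real.rpow_le_rpow (by positivity) (hle.trans_eq ?_) hp
  rw [Real.rpow_sub hc, Real.rpow_one]
  field_simp

/-- An upper power bound on the growth of `Φ` bounds the growth of `(τ / Φ τ) ^ p` from below. -/
theorem le_div_rpow_mul {Φ : ℝ → ℝ} {a p c s : ℝ} (hp : 0 ≤ p) (hc : 0 < c) (hs : 0 < s)
    (hΦs : 0 < Φ s) (hΦcs : 0 < Φ (c * s)) (h : Φ (c * s) ≤ c ^ a * Φ s) :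
    c ^ ((1 - a) * p) * (s / Φ s) ^ p ≤ (c * s / Φ (c * s)) ^ p := by
  have hca := Real.rpow_pos_of_pos hc a
  rw [Real.rpow_mul hc.le, ← Real.mul_rpow (Real.rpow_nonneg hc.le _) (div_pos hs hΦs).le]
  have hle : c * s / (c ^ a * Φ s) ≤ c * s / Φ (c * s) := by gcongr
  refine Real.rpow_le_rpow (by positivity) (le_trans (le_of_eq ?_) hle) hp
  rw [Real.rpow_sub hc, Real.rpow_one]
  field_simp

theorem intervalIntegrable_div_rpow {Φ : ℝ → ℝ} {a p : ℝ} (hp : 0 ≤ p)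
    (hap : -1 < (1 - a) * p) (hcont : ContinuousOn Φ (Ioi 0)) (hpos : ∀ t : ℝ, 0 < t → 0 < Φ t)
    (hup : ∀ c s : ℝ, 1 ≤ c → 0 < s → Φ (c * s) ≤ c ^ a * Φ s) {T : ℝ} (hT : 0 ≤ T) :
    IntervalIntegrable (fun τ => (τ / Φ τ) ^ p) volume 0 T := by
  have hg : ContinuousOn (fun τ => (τ / Φ τ) ^ p) (Ioi 0) :=
    (continuousOn_id.div hcont fun x hx => (hpos x hx).ne').rpow_const fun _ _ => Or.inr hp
  have hmaj : IntervalIntegrable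
      (fun τ : ℝ => (T ^ ((1 - a) * p))⁻¹ * (T / Φ T) ^ p * τ ^ ((1 - a) * p)) volume 0 T :=
    (intervalIntegral.intervalIntegrable_rpow' hap).const_mul _
  rw [intervalIntegrable_iff_integrableOn_Ioc_of_le hT] at hmaj ⊢
  refine hmaj.mono' ((hg.mono fun x hx => hx.1).aestronglyMeasurable measurableSet_Ioc) ?_
  refine (ae_restrict_iff' measurableSet_Ioc).2 (.of_forall fun τ hτ => ?_)
  obtain ⟨h0, h1⟩ := hτ
  have hT0 : 0 < T := h0.trans_le h1
  have hc : 1 ≤ T / τ := (one_le_div h0).2 h1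
  have e : T / τ * τ = T := div_mul_cancel₀ _ h0.ne'
  have key := le_div_rpow_mul hp (by linarith) h0 (hpos τ h0) (by rw [e]; exact hpos T hT0)
    (hup (T / τ) τ hc h0)
  rw [e, Real.div_rpow hT0.le h0.le] at key
  rw [Real.norm_of_nonneg (Real.rpow_nonneg (div_pos h0 (hpos τ h0)).le _)]
  have h2 := Real.rpow_pos_of_pos h0 ((1 - a) * p)
  have h3 := Real.rpow_pos_of_pos hT0 ((1 - a) * p)
  calc (τ / Φ τ) ^ p
      = (T ^ ((1 - a) * p))⁻¹ * τ ^ ((1 - a) * p) *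
          (T ^ ((1 - a) * p) / τ ^ ((1 - a) * p) * (τ / Φ τ) ^ p) := by field_simp
    _ ≤ (T ^ ((1 - a) * p))⁻¹ * τ ^ ((1 - a) * p) * (T / Φ T) ^ p := by gcongr
    _ = _ := by ring

theorem rpow_mul_integral_le {g : ℝ → ℝ} {b c s : ℝ} (hc : 0 < c) (hs : 0 ≤ s)
    (hg : ∀ T : ℝ, 0 ≤ T → IntervalIntegrable g volume 0 T)
    (h : ∀ τ : ℝ, 0 < τ → c ^ b * g τ ≤ g (c * τ)) :
    c ^ (1 + b) * ∫ τ in (0 : ℝ)..s, g τ ≤ ∫ τ in (0 : ℝ)..(c * s), g τ := by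
  have hgc : IntervalIntegrable (fun τ => g (c * τ)) volume 0 s := by
    have := (hg (c * s) (by positivity)).comp_mul_left (c := c)
    simpa [hc.ne'] using this
  have hsub := intervalIntegral.mul_integral_comp_mul_left (f := g) (a := 0) (b := s) c
  rw [mul_zero] at hsub
  rw [← hsub, Real.rpow_add hc, Real.rpow_one, mul_assoc, ← intervalIntegral.integral_const_mul]
  refine mul_le_mul_of_nonneg_left ?_ hc.le
  exact intervalIntegral.integral_mono_on_of_le_Ioo hs ((hg s hs).const_mul _) hgc
    fun x hx => h x hx.1

theorem integral_le_rpow_mul {g : ℝ → ℝ} {b c s : ℝ} (hc : 0 < c) (hs : 0 ≤ s)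
    (hg : ∀ T : ℝ, 0 ≤ T → IntervalIntegrable g volume 0 T)
    (h : ∀ τ : ℝ, 0 < τ → g (c * τ) ≤ c ^ b * g τ) :
    ∫ τ in (0 : ℝ)..(c * s), g τ ≤ c ^ (1 + b) * ∫ τ in (0 : ℝ)..s, g τ := by
  have := rpow_mul_integral_le (g := fun τ => -g τ) (b := b) hc hs (fun T hT => (hg T hT).neg)
    fun τ hτ => by linarith [h τ hτ]
  simp only [intervalIntegral.integral_neg, mul_neg] at this
  linarith

/-- A strictly increasing continuous function on `[0, ∞)` that vanishes at `0` and is bounded below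
by a multiple of a positive power is a bijection of `[0, ∞)`. -/
theorem bijOn_Ici_of_rpow_le {N : ℝ → ℝ} {b C : ℝ} (hb : 0 < b) (hC : 0 < C)
    (hmono : StrictMonoOn N (Ici 0)) (hcont : ContinuousOn N (Ici 0)) (h0 : N 0 = 0)
    (h : ∀ c : ℝ, 1 ≤ c → c ^ b * C ≤ N c) : BijOn N (Ici 0) (Ici 0) := by
  refine ⟨fun t ht => ?_, hmono.injOn, fun y hy => ?_⟩
  · have := hmono.monotoneOn self_mem_Ici ht ht
    rwa [h0] at this
  · have hlim := (tendsto_rpow_atTop hb).atTop_mul_const hC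
    obtain ⟨c, hyc, hc⟩ :=
      ((hlim.eventually_ge_atTop y).and (Filter.eventually_ge_atTop 1)).exists
    have hc0 : (0 : ℝ) ≤ c := by linarith
    obtain ⟨x, hx, rfl⟩ := intermediate_value_Icc hc0 (hcont.mono Icc_subset_Ici_self)
      (show y ∈ Icc (N 0) (N c) from ⟨h0.trans_le hy, hyc.trans (h c hc)⟩)
    exact ⟨x, hx.1, rfl⟩

/-- Power bounds for `Φ` and `N` combine to power bounds for `Φ ∘ N⁻¹`. -/
theorem conjugate_bounds_of_le {Φ N : ℝ → ℝ} {d m ℓ s s' t : ℝ} (hd : 0 < d) (hm : 0 < m)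
    (hmd : m < d) (hℓ : 0 < ℓ) (hℓd : ℓ < d) (hs : 0 < s) (hss' : s ≤ s') (ht : 0 < t)
    (hΦs : 0 ≤ Φ s) (hNs : 0 < N s)
    (hΦ : ∀ c s : ℝ, 1 ≤ c → 0 < s → c ^ m * Φ s ≤ Φ (c * s) ∧ Φ (c * s) ≤ c ^ ℓ * Φ s)
    (hN : ∀ c s : ℝ, 1 ≤ c → 0 < s →
      c ^ ((d - ℓ) / d) * N s ≤ N (c * s) ∧ N (c * s) ≤ c ^ ((d - m) / d) * N s)
    (hts : N s' = t * N s) :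
    t ^ (d * m / (d - m)) * Φ s ≤ Φ s' ∧ Φ s' ≤ t ^ (d * ℓ / (d - ℓ)) * Φ s := by
  have hc : 1 ≤ s' / s := (one_le_div hs).2 hss'
  have e : s' / s * s = s' := div_mul_cancel₀ _ hs.ne'
  obtain ⟨hΦ1, hΦ2⟩ := hΦ _ s hc hs
  obtain ⟨hN1, hN2⟩ := hN _ s hc hs
  rw [e] at hΦ1 hΦ2 hN1 hN2
  rw [hts] at hN1 hN2
  have hN1 := le_of_mul_le_mul_right hN1 hNs
  have hN2 := le_of_mul_le_mul_right hN2 hNs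
  have hc0 : 0 < s' / s := by linarith
  have hexp : ∀ a : ℝ, a < d → (s' / s) ^ a = ((s' / s) ^ ((d - a) / d)) ^ (d * a / (d - a)) := by
    intro a ha
    have : d - a ≠ 0 := by linarith
    rw [← Real.rpow_mul hc0.le]
    congr 1
    field_simp
  have hpm : 0 ≤ d * m / (d - m) := div_nonneg (by positivity) (by linarith)
  have hpℓ : 0 ≤ d * ℓ / (d - ℓ) := div_nonneg (by positivity) (by linarith)
  constructor
  · refine le_trans (mul_le_mul_of_nonneg_right ?_ hΦs) hΦ1
    rw [hexp m hmd]
    exact Real.rpow_le_rpow ht.le hN2 hpm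
  · refine hΦ2.trans (mul_le_mul_of_nonneg_right ?_ hΦs)
    rw [hexp ℓ hℓd]
    exact Real.rpow_le_rpow (Real.rpow_nonneg hc0.le _) hN1 hpℓ

/-- Let `d ≥ 2` and let `Φ` be a Young function satisfying the
elasticity condition with constants `1 < m ≤ ℓ < d`, and let
`N(t) = (∫₀ᵗ (τ/Φ(τ))^{1/(d−1)} dτ)^{(d−1)/d}`. Then `N` is a strictly increasing
bijection of `[0,∞)` onto itself, and the Sobolev conjugate `Φ*(t) = Φ(N⁻¹(t))`
satisfies `min (t^{m*}) (t^{ℓ*}) Φ*(ξ) ≤ Φ*(tξ) ≤ max (t^{m*}) (t^{ℓ*}) Φ*(ξ)` for all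
`t, ξ ≥ 0`, where `m* = dm/(d−m)` and `ℓ* = dℓ/(d−ℓ)`. -/
theorem stmt12
    (d : ℕ) (hd : 2 ≤ d)
    (Φ φ : ℝ → ℝ) (m ℓ : ℝ)
    -- Φ is a Young function
    (hconv : ConvexOn ℝ (Set.Ici (0 : ℝ)) Φ)
    (hcont : ContinuousOn Φ (Set.Ici (0 : ℝ)))
    (hΦ0 : Φ 0 = 0)
    (hnonneg : ∀ t : ℝ, 0 ≤ t → 0 ≤ Φ t)
    (hnonconst : ∃ t : ℝ, 0 ≤ t ∧ Φ t ≠ 0)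
    -- elasticity condition with constants 1 < m ≤ ℓ < d
    (h1m : 1 < m) (hmℓ : m ≤ ℓ) (hℓd : ℓ < d)
    (hderiv : ∀ t : ℝ, 0 < t → HasDerivAt Φ (φ t) t)
    (hpos : ∀ t : ℝ, 0 < t → 0 < Φ t)
    (helast : ∀ t : ℝ, 0 < t → m ≤ t * φ t / Φ t ∧ t * φ t / Φ t ≤ ℓ)
    -- the function N and the Sobolev conjugate Φ* = Φ ∘ N⁻¹
    (N : ℝ → ℝ)
    (hN : ∀ t : ℝ, N t =
      (∫ τ in Set.Ioc (0 : ℝ) t, (τ / Φ τ) ^ ((1 : ℝ) / ((d : ℝ) - 1))) ^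
        (((d : ℝ) - 1) / (d : ℝ)))
    (Φstar : ℝ → ℝ)
    (hΦstar : ∀ s : ℝ, Φstar s = Φ (Function.invFunOn N (Set.Ici (0 : ℝ)) s)) :
    (StrictMonoOn N (Set.Ici (0 : ℝ)) ∧
        Set.BijOn N (Set.Ici (0 : ℝ)) (Set.Ici (0 : ℝ))) ∧
      ∀ t ξ : ℝ, 0 ≤ t → 0 ≤ ξ →
        min (t ^ ((d : ℝ) * m / ((d : ℝ) - m))) (t ^ ((d : ℝ) * ℓ / ((d : ℝ) - ℓ))) *
            Φstar ξ ≤ Φstar (t * ξ) ∧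
          Φstar (t * ξ) ≤
            max (t ^ ((d : ℝ) * m / ((d : ℝ) - m))) (t ^ ((d : ℝ) * ℓ / ((d : ℝ) - ℓ))) *
              Φstar ξ := by
  have hd2 : (2 : ℝ) ≤ d := by exact_mod_cast hd
  have hd0 : (0 : ℝ) < d := by linarith
  have hd1 : (0 : ℝ) < (d : ℝ) - 1 := by linarith
  set p : ℝ := 1 / ((d : ℝ) - 1) with hp_def
  have hp : 0 < p := one_div_pos.2 hd1
  set q : ℝ := ((d : ℝ) - 1) / d with hq_def
  have hq : 0 < q := div_pos hd1 hd0
  have hexp : ∀ a : ℝ, (1 + (1 - a) * p) * q = (d - a) / d := by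
    intro a
    rw [hp_def, hq_def]
    field_simp
    ring
  have hℓp : -1 < (1 - ℓ) * p := by
    rw [hp_def, mul_one_div, lt_div_iff₀ hd1]
    linarith
  have hΦ : ∀ c s : ℝ, 1 ≤ c → 0 < s → c ^ m * Φ s ≤ Φ (c * s) ∧ Φ (c * s) ≤ c ^ ℓ * Φ s :=
    fun c s hc hs =>
      ⟨rpow_mul_le_of_elasticity_ge hderiv
        (fun t ht => (le_div_iff₀ (hpos t ht)).1 (helast t ht).1) hc hs,
      le_rpow_mul_of_elasticity_le hderiv
        (fun t ht => (div_le_iff₀ (hpos t ht)).1 (helast t ht).2) hc hs⟩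
  set g : ℝ → ℝ := fun τ => (τ / Φ τ) ^ p with hg_def
  have hg : ∀ T : ℝ, 0 ≤ T → IntervalIntegrable g volume 0 T := fun T hT =>
    intervalIntegrable_div_rpow hp.le hℓp (hcont.mono Ioi_subset_Ici_self) hpos
      (fun c s hc hs => (hΦ c s hc hs).2) hT
  have hg_pos : ∀ τ : ℝ, 0 < τ → 0 < g τ := fun τ hτ =>
    Real.rpow_pos_of_pos (div_pos hτ (hpos τ hτ)) _
  set I : ℝ → ℝ := fun t => ∫ τ in (0 : ℝ)..t, g τ with hI_def
  have hNI : ∀ t : ℝ, 0 ≤ t → N t = I t ^ q := fun t ht => by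
    rw [hN, hI_def]
    simp only [intervalIntegral.integral_of_le ht, hg_def]
  have hI0 : I 0 = 0 := intervalIntegral.integral_same
  have hImono : StrictMonoOn I (Ici 0) := by
    intro x hx y hy hxy
    have hx : 0 ≤ x := hx
    have hxy_int := (hg x hx).symm.trans (hg y hy)
    rw [← sub_pos, hI_def]
    simp only [intervalIntegral.integral_interval_sub_left (hg y hy) (hg x hx)]
    exact intervalIntegral.intervalIntegral_pos_of_pos_on hxy_int
      (fun τ hτ => hg_pos τ (hx.trans_lt hτ.1)) hxy
  have hI_nonneg : ∀ t : ℝ, 0 ≤ t → 0 ≤ I t := fun t ht =>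
    hI0.symm.trans_le (hImono.monotoneOn self_mem_Ici ht ht)
  have hIcont : ContinuousOn I (Ici 0) := by
    intro x hx
    have hx : 0 ≤ x := hx
    have hc := intervalIntegral.continuousOn_primitive_interval' (hg (x + 1) (by linarith))
      left_mem_uIcc
    rw [uIcc_of_le (by linarith)] at hc
    refine (hc x ⟨hx, by linarith⟩).mono_of_mem_nhdsWithin ?_
    rw [← Ici_inter_Iic]
    exact Filter.inter_mem self_mem_nhdsWithin
      (mem_nhdsWithin_of_mem_nhds (Iic_mem_nhds (by linarith)))
  have hNmono : StrictMonoOn N (Ici 0) := by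
    intro x hx y hy hxy
    rw [hNI x hx, hNI y hy]
    exact Real.rpow_lt_rpow (hI_nonneg x hx) (hImono hx hy hxy) hq
  have hN0 : N 0 = 0 := by rw [hNI 0 le_rfl, hI0, Real.zero_rpow hq.ne']
  have hN_pos : ∀ t : ℝ, 0 < t → 0 < N t := fun t ht =>
    hN0.symm.trans_lt (hNmono self_mem_Ici ht.le ht)
  have hNcont : ContinuousOn N (Ici 0) :=
    (hIcont.rpow_const fun _ _ => Or.inr hq.le).congr fun t ht => hNI t ht
  have hNscale : ∀ c s : ℝ, 1 ≤ c → 0 < s →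
      c ^ ((d - ℓ) / d) * N s ≤ N (c * s) ∧ N (c * s) ≤ c ^ ((d - m) / d) * N s := by
    intro c s hc hs
    have hc0 : 0 < c := by linarith
    have hcs : 0 < c * s := mul_pos hc0 hs
    have hpow : ∀ a : ℝ, c ^ ((d - a) / d) * N s = (c ^ (1 + (1 - a) * p) * I s) ^ q := by
      intro a
      rw [Real.mul_rpow (Real.rpow_nonneg hc0.le _) (hI_nonneg s hs.le), ← Real.rpow_mul hc0.le,
        hexp, hNI s hs.le]
    rw [hpow, hpow, hNI _ hcs.le]
    constructor
    · refine Real.rpow_le_rpow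
        (mul_nonneg (Real.rpow_nonneg hc0.le _) (hI_nonneg s hs.le)) ?_ hq.le
      exact rpow_mul_integral_le hc0 hs.le hg fun τ hτ =>
        le_div_rpow_mul hp.le hc0 hτ (hpos τ hτ) (hpos _ (mul_pos hc0 hτ)) (hΦ c τ hc hτ).2
    · refine Real.rpow_le_rpow (hI_nonneg _ hcs.le) ?_ hq.le
      exact integral_le_rpow_mul hc0 hs.le hg fun τ hτ =>
        div_rpow_mul_le hp.le hc0 hτ (hpos τ hτ) (hΦ c τ hc hτ).1
  have hbij : BijOn N (Ici 0) (Ici 0) :=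
    bijOn_Ici_of_rpow_le (b := (d - ℓ) / d) (div_pos (by linarith) hd0) (hN_pos 1 one_pos)
      hNmono hNcont hN0 fun c hc => by simpa using (hNscale c 1 hc one_pos).1
  refine ⟨⟨hNmono, hbij⟩, fun t ξ ht hξ => ?_⟩
  have hstar : ∀ s : ℝ, 0 ≤ s → Φstar (N s) = Φ s := fun s hs => by
    rw [hΦstar, hbij.injOn.leftInvOn_invFunOn hs]
  have hstar0 : Φstar 0 = 0 := by simpa only [hN0, hΦ0] using hstar 0 le_rfl
  have hmd : m < d := by linarith
  have hms : 0 < (d : ℝ) * m / (d - m) := div_pos (by positivity) (by linarith)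
  have hℓs : 0 < (d : ℝ) * ℓ / (d - ℓ) := div_pos (mul_pos hd0 (by linarith)) (by linarith)
  rcases ht.eq_or_lt with rfl | ht
  · simp [Real.zero_rpow hms.ne', Real.zero_rpow hℓs.ne', hstar0]
  rcases hξ.eq_or_lt with rfl | hξ
  · simp [hstar0]
  have hpre : ∀ y : ℝ, 0 < y → ∃ s, 0 < s ∧ N s = y := by
    intro y hy
    obtain ⟨s, hs, rfl⟩ := hbij.surjOn hy.le
    refine ⟨s, lt_of_le_of_ne hs ?_, rfl⟩
    rintro rfl
    exact hy.ne' hN0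
  obtain ⟨s, hs, rfl⟩ := hpre ξ hξ
  obtain ⟨s', hs', hts⟩ := hpre (t * N s) (mul_pos ht hξ)
  rw [← hts, hstar s hs.le, hstar s' hs'.le]
  have hΦs := hnonneg s hs.le
  rcases le_total s s' with hss' | hss'
  · obtain ⟨h1, h2⟩ := conjugate_bounds_of_le hd0 (by linarith) hmd (by linarith) hℓd hs hss' ht
      hΦs hξ hΦ hNscale hts
    exact ⟨(mul_le_mul_of_nonneg_right (min_le_left _ _) hΦs).trans h1,
      h2.trans (mul_le_mul_of_nonneg_right (le_max_right _ _) hΦs)⟩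
  · obtain ⟨h1, h2⟩ := conjugate_bounds_of_le hd0 (by linarith) hmd (by linarith) hℓd hs' hss'
      (inv_pos.2 ht) (hnonneg s' hs'.le) (hN_pos s' hs') hΦ hNscale
      (by rw [hts, inv_mul_cancel_left₀ ht.ne'])
    rw [Real.inv_rpow ht.le, inv_mul_le_iff₀ (Real.rpow_pos_of_pos ht _)] at h1
    rw [Real.inv_rpow ht.le, le_inv_mul_iff₀ (Real.rpow_pos_of_pos ht _)] at h2
    exact ⟨(mul_le_mul_of_nonneg_right (min_le_right _ _) hΦs).trans h2,
      h1.trans (mul_le_mul_of_nonneg_right (le_max_left _ _) hΦs)⟩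
end

section
/- Let d ≥ 2 be an integer and let Φ be a Young function satisfying the elasticity condition with constants 1 < m ≤ ℓ < d, and assume in addition that the derivative φ of Φ is continuous and strictly positive on (0,∞). Define N(t) = (∫₀ᵗ (τ/Φ(τ))^{1/(d−1)} dτ)^{(d−1)/d} and Φ*(t) = Φ(N⁻¹(t)). Then Φ* is differentiable on (0,∞) with derivative φ*, and m* ≤ t·φ*(t)/Φ*(t) ≤ ℓ* for all t > 0, where m* = dm/(d−m) and ℓ* = dℓ/(d−ℓ). -/
open Set MeasureTheory

/-- A lower bound on the elasticity of a positive function makes `f t / t ^ m` increasing. -/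
lemma le_mul_div_rpow_of_le_elasticity {f f' : ℝ → ℝ} {m : ℝ}
    (hf : ∀ t, 0 < t → HasDerivAt f (f' t) t) (hpos : ∀ t, 0 < t → 0 < f t)
    (hm : ∀ t, 0 < t → m ≤ t * f' t / f t) {s t : ℝ} (hs : 0 < s) (hst : s ≤ t) :
    f s ≤ f t * (s / t) ^ m := by
  have hd : ∀ x, 0 < x →
      HasDerivAt (fun x => Real.log (f x) - m * Real.log x) (f' x / f x - m * x⁻¹) x :=
    fun x hx => ((hf x hx).log (hpos x hx).ne').sub ((Real.hasDerivAt_log hx.ne').const_mul m)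
  have hmono : MonotoneOn (fun x => Real.log (f x) - m * Real.log x) (Ioi 0) := by
    refine monotoneOn_of_deriv_nonneg (convex_Ioi 0)
      (fun x hx => (hd x hx).continuousAt.continuousWithinAt) ?_ ?_ <;> rw [interior_Ioi]
    · exact fun x hx => (hd x hx).differentiableAt.differentiableWithinAt
    · intro x hx
      have hx : 0 < x := hx
      rw [(hd x hx).deriv, sub_nonneg, ← div_eq_mul_inv, div_le_iff₀ hx]
      exact (hm x hx).trans_eq (by ring)
  have ht := hs.trans_le hst
  have h := hmono hs ht hst
  have hq : 0 < s / t := div_pos hs ht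
  have hr : 0 < (s / t) ^ m := Real.rpow_pos_of_pos hq m
  rw [← Real.log_le_log_iff (hpos s hs) (mul_pos (hpos t ht) hr),
    Real.log_mul (hpos t ht).ne' hr.ne', Real.log_rpow hq, Real.log_div hs.ne' ht.ne']
  simp only at h
  linarith

/-- An upper bound on the elasticity of a positive function makes `f t / t ^ l` decreasing. -/
lemma mul_div_rpow_le_of_elasticity_le {f f' : ℝ → ℝ} {l : ℝ}
    (hf : ∀ t, 0 < t → HasDerivAt f (f' t) t) (hpos : ∀ t, 0 < t → 0 < f t)
    (hl : ∀ t, 0 < t → t * f' t / f t ≤ l) {s t : ℝ} (hs : 0 < s) (hst : s ≤ t) :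
    f t * (s / t) ^ l ≤ f s := by
  have ht := hs.trans_le hst
  have h := le_mul_div_rpow_of_le_elasticity (f := fun x => (f x)⁻¹) (m := -l)
    (fun x hx => (hf x hx).inv (hpos x hx).ne') (fun x hx => inv_pos.2 (hpos x hx))
    (fun x hx => by
      have h0 := (hpos x hx).ne'
      have : x * (-f' x / f x ^ 2) / (f x)⁻¹ = -(x * f' x / f x) := by field_simp
      rw [this]
      exact neg_le_neg (hl x hx)) hs hst
  rw [Real.rpow_neg (div_pos hs ht).le, ← mul_inv] at h
  exact (inv_le_inv₀ (hpos s hs)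
    (mul_pos (hpos t ht) (Real.rpow_pos_of_pos (div_pos hs ht) l))).1 h

lemma div_rpow_eq_mul_div_rpow {s t c m a : ℝ} (hs : 0 < s) (ht : 0 < t) (hc : 0 < c) :
    (s / (c * (s / t) ^ m)) ^ a = (t / c) ^ a * (s / t) ^ ((1 - m) * a) := by
  have hq : 0 < s / t := div_pos hs ht
  rw [Real.rpow_mul hq.le, ← Real.mul_rpow (by positivity) (by positivity),
    Real.rpow_sub hq, Real.rpow_one]
  congr 1
  field_simp

lemma intervalIntegrable_div_rpow_s13 {t r : ℝ} (hr : -1 < r) :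
    IntervalIntegrable (fun x => (x / t) ^ r) volume 0 t := by
  have h := (intervalIntegral.intervalIntegrable_rpow' (a := 0) (b := 1) hr).comp_mul_right
    (c := t⁻¹) enorm_ne_top enorm_ne_top
  simpa [div_eq_mul_inv] using h

lemma integral_div_rpow {t r : ℝ} (ht : 0 < t) (hr : -1 < r) :
    ∫ x in (0 : ℝ)..t, (x / t) ^ r = t / (r + 1) := by
  rw [intervalIntegral.integral_comp_div (fun x => x ^ r) ht.ne', zero_div, div_self ht.ne',
    integral_rpow (Or.inl hr), Real.one_rpow, Real.zero_rpow (by linarith)]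
  simp [div_eq_mul_inv]

/-- The primitive of a function squeezed between two power functions is comparable to `t * g t`. -/
lemma primitive_bounds_of_power_bounds {g : ℝ → ℝ} {q r : ℝ} (hr : -1 < r) (hq : -1 < q)
    (hg : ContinuousOn g (Ioi 0)) (hpos : ∀ t, 0 < t → 0 < g t)
    (hlow : ∀ s t, 0 < s → s ≤ t → g t * (s / t) ^ q ≤ g s)
    (hupp : ∀ s t, 0 < s → s ≤ t → g s ≤ g t * (s / t) ^ r) {t : ℝ} (ht : 0 < t) :
    IntervalIntegrable g volume 0 t ∧ g t * (t / (q + 1)) ≤ ∫ x in (0 : ℝ)..t, g x ∧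
      ∫ x in (0 : ℝ)..t, g x ≤ g t * (t / (r + 1)) := by
  have hI := (intervalIntegrable_div_rpow_s13 (t := t) hr).const_mul (g t)
  have hJ := (intervalIntegrable_div_rpow_s13 (t := t) hq).const_mul (g t)
  have hgI : IntervalIntegrable g volume 0 t := by
    refine hI.mono_fun ?_ ?_
    · rw [uIoc_of_le ht.le]
      exact (hg.mono fun x hx => hx.1).aestronglyMeasurable measurableSet_Ioc
    · rw [uIoc_of_le ht.le]
      filter_upwards [ae_restrict_mem measurableSet_Ioc] with x hx
      rw [Real.norm_of_nonneg (hpos x hx.1).le]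
      exact (hupp x t hx.1 hx.2).trans (Real.le_norm_self _)
  refine ⟨hgI, ?_, ?_⟩
  · rw [← integral_div_rpow ht hq, ← intervalIntegral.integral_const_mul]
    exact intervalIntegral.integral_mono_on_of_le_Ioo ht.le hJ hgI
      fun x hx => hlow x t hx.1 hx.2.le
  · rw [← integral_div_rpow ht hr, ← intervalIntegral.integral_const_mul]
    exact intervalIntegral.integral_mono_on_of_le_Ioo ht.le hgI hI
      fun x hx => hupp x t hx.1 hx.2.le

/-- Let `d ≥ 2` and let `Φ` be a Young function satisfying the
elasticity condition with constants `1 < m ≤ ℓ < d`, whose derivative `φ` is continuous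
and strictly positive on `(0,∞)`. With `N(t) = (∫₀ᵗ (τ/Φ(τ))^{1/(d−1)} dτ)^{(d−1)/d}`
and `Φ*(t) = Φ(N⁻¹(t))`, the conjugate `Φ*` is differentiable on `(0,∞)` with some
derivative `φ*` satisfying `m* ≤ t φ*(t)/Φ*(t) ≤ ℓ*` for all `t > 0`, where
`m* = dm/(d−m)` and `ℓ* = dℓ/(d−ℓ)`. -/
theorem stmt13
    (d : ℕ) (hd : 2 ≤ d)
    (Φ φ : ℝ → ℝ) (m ℓ : ℝ)
    -- Φ is a Young function
    (hconv : ConvexOn ℝ (Set.Ici (0 : ℝ)) Φ)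
    (hcont : ContinuousOn Φ (Set.Ici (0 : ℝ)))
    (hΦ0 : Φ 0 = 0)
    (hnonneg : ∀ t : ℝ, 0 ≤ t → 0 ≤ Φ t)
    (hnonconst : ∃ t : ℝ, 0 ≤ t ∧ Φ t ≠ 0)
    -- elasticity condition with constants 1 < m ≤ ℓ < d
    (h1m : 1 < m) (hmℓ : m ≤ ℓ) (hℓd : ℓ < d)
    (hderiv : ∀ t : ℝ, 0 < t → HasDerivAt Φ (φ t) t)
    (hpos : ∀ t : ℝ, 0 < t → 0 < Φ t)
    (helast : ∀ t : ℝ, 0 < t → m ≤ t * φ t / Φ t ∧ t * φ t / Φ t ≤ ℓ)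
    -- φ is continuous and strictly positive on (0,∞)
    (hφcont : ContinuousOn φ (Set.Ioi (0 : ℝ)))
    (hφpos : ∀ t : ℝ, 0 < t → 0 < φ t)
    -- the function N and the Sobolev conjugate Φ* = Φ ∘ N⁻¹
    (N : ℝ → ℝ)
    (hN : ∀ t : ℝ, N t =
      (∫ τ in Set.Ioc (0 : ℝ) t, (τ / Φ τ) ^ ((1 : ℝ) / ((d : ℝ) - 1))) ^
        (((d : ℝ) - 1) / (d : ℝ)))
    (Φstar : ℝ → ℝ)
    (hΦstar : ∀ s : ℝ, Φstar s = Φ (Function.invFunOn N (Set.Ici (0 : ℝ)) s)) :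
    ∃ φstar : ℝ → ℝ,
      (∀ t : ℝ, 0 < t → HasDerivAt Φstar (φstar t) t) ∧
        ∀ t : ℝ, 0 < t →
          (d : ℝ) * m / ((d : ℝ) - m) ≤ t * φstar t / Φstar t ∧
            t * φstar t / Φstar t ≤ (d : ℝ) * ℓ / ((d : ℝ) - ℓ) := by
  have hd2 : (2 : ℝ) ≤ d := by exact_mod_cast hd
  have hd1 : (0 : ℝ) < d - 1 := by linarith
  have hd0 : (0 : ℝ) < d := by linarith
  have hdl : (0 : ℝ) < d - ℓ := by linarith
  have hdm : (0 : ℝ) < d - m := by linarith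
  set a : ℝ := 1 / ((d : ℝ) - 1) with ha
  have ha0 : 0 < a := by positivity
  set g : ℝ → ℝ := fun τ => (τ / Φ τ) ^ a with hgdef
  have hgpos : ∀ t, 0 < t → 0 < g t := fun t ht =>
    Real.rpow_pos_of_pos (div_pos ht (hpos t ht)) _
  have hgcont : ContinuousOn g (Ioi 0) := by
    refine ContinuousOn.rpow_const (continuousOn_id.div
      (hcont.mono Ioi_subset_Ici_self) fun x hx => (hpos x hx).ne') fun x hx => Or.inr ha0.le
  have hlow : ∀ s t, 0 < s → s ≤ t → g t * (s / t) ^ ((1 - m) * a) ≤ g s := by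
    intro s t hs hst
    have ht := hs.trans_le hst
    rw [hgdef, ← div_rpow_eq_mul_div_rpow hs ht (hpos t ht)]
    have h := le_mul_div_rpow_of_le_elasticity hderiv hpos (fun x hx => (helast x hx).1) hs hst
    have hs' := hpos s hs
    have ht' := hpos t ht
    dsimp only
    gcongr
  have hupp : ∀ s t, 0 < s → s ≤ t → g s ≤ g t * (s / t) ^ ((1 - ℓ) * a) := by
    intro s t hs hst
    have ht := hs.trans_le hst
    rw [hgdef, ← div_rpow_eq_mul_div_rpow hs ht (hpos t ht)]
    have h := mul_div_rpow_le_of_elasticity_le hderiv hpos (fun x hx => (helast x hx).2) hs hst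
    have hs' := hpos s hs
    have ht' := hpos t ht
    dsimp only
    gcongr
  have hm1 : (1 - m) * a + 1 = (d - m) / (d - 1) := by rw [ha]; field_simp; ring
  have hl1 : (1 - ℓ) * a + 1 = (d - ℓ) / (d - 1) := by rw [ha]; field_simp; ring
  have hq : -1 < (1 - m) * a := by have := div_pos hdm hd1; linarith
  have hr : -1 < (1 - ℓ) * a := by have := div_pos hdl hd1; linarith
  have hprim := fun t (ht : 0 < t) =>
    primitive_bounds_of_power_bounds hr hq hgcont hgpos hlow hupp ht
  rw [hm1, hl1] at hprim
  set F : ℝ → ℝ := fun t => ∫ x in (0 : ℝ)..t, g x with hFdef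
  have hFpos : ∀ t, 0 < t → 0 < F t := fun t ht =>
    intervalIntegral.intervalIntegral_pos_of_pos_on (hprim t ht).1 (fun x hx => hgpos x hx.1) ht
  have hFderiv : ∀ t, 0 < t → HasStrictDerivAt F (g t) t := fun t ht =>
    intervalIntegral.integral_hasStrictDerivAt_right (hprim t ht).1
      (hgcont.stronglyMeasurableAtFilter isOpen_Ioi t ht) (hgcont.continuousAt (Ioi_mem_nhds ht))
  have hNF : ∀ t, 0 ≤ t → N t = F t ^ (((d : ℝ) - 1) / d) := by
    intro t ht
    rw [hN, hFdef]
    simp only [intervalIntegral.integral_of_le ht, hgdef]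
  have hF0 : F 0 = 0 := intervalIntegral.integral_same
  have hp0 : 0 < ((d : ℝ) - 1) / d := by positivity
  have hFcont : ∀ T, 0 < T → ContinuousOn F (Icc 0 T) := by
    intro T hT
    have h := intervalIntegral.continuousOn_primitive_interval
      ((intervalIntegrable_iff_integrableOn_Icc_of_le hT.le).1 (hprim T hT).1 |>.mono_set
        (uIcc_of_le hT.le).subset)
    rwa [uIcc_of_le hT.le] at h
  have hFmono : StrictMonoOn F (Ici 0) := by
    refine strictMonoOn_of_deriv_pos (convex_Ici 0) ?_ ?_
    · intro x hx
      have hx0 : (0 : ℝ) ≤ x := hx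
      refine ((hFcont (x + 1) (by linarith)) x ⟨hx, by linarith⟩).mono_of_mem_nhdsWithin ?_
      exact Filter.mem_of_superset (inter_mem_nhdsWithin _ (Iio_mem_nhds (lt_add_one x)))
        fun y hy => ⟨hy.1, le_of_lt hy.2⟩
    · rw [interior_Ici]
      intro x hx
      rw [(hFderiv x hx).hasDerivAt.deriv]
      exact hgpos x hx
  have hNmono : StrictMonoOn N (Ici 0) := by
    intro x hx y hy hxy
    have hx0 : (0 : ℝ) ≤ x := hx
    rw [hNF x hx, hNF y hy]
    exact Real.rpow_lt_rpow (hF0 ▸ hFmono.monotoneOn self_mem_Ici hx hx0) (hFmono hx hy hxy) hp0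
  have hFunbdd : ∀ y, ∃ T, 0 < T ∧ y ≤ F T := by
    intro y
    set e : ℝ := (1 - ℓ) * a + 1 with he
    have he0 : 0 < e := by linarith
    set c : ℝ := g 1 / ((d - m) / (d - 1)) with hc
    have hc0 : 0 < c := div_pos (hgpos 1 one_pos) (div_pos hdm hd1)
    obtain ⟨T, hT1, hTy⟩ := ((Filter.eventually_ge_atTop (1 : ℝ)).and
      (((tendsto_rpow_atTop he0).const_mul_atTop hc0).eventually_ge_atTop y)).exists
    have hT : 0 < T := by linarith
    refine ⟨T, hT, hTy.trans (le_trans ?_ (hprim T hT).2.1)⟩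
    have h := hupp 1 T one_pos hT1
    rw [one_div, Real.inv_rpow hT.le, ← div_eq_mul_inv,
      le_div_iff₀ (Real.rpow_pos_of_pos hT _)] at h
    rw [he, Real.rpow_add_one hT.ne', hc]
    calc g 1 / ((d - m) / (d - 1)) * (T ^ ((1 - ℓ) * a) * T)
        = g 1 * T ^ ((1 - ℓ) * a) * (T / ((d - m) / (d - 1))) := by ring
      _ ≤ g T * (T / ((d - m) / (d - 1))) := by gcongr
  have hsurj : ∀ s, 0 < s → ∃ t, 0 < t ∧ N t = s := by
    intro s hs
    set y := s ^ (((d : ℝ) - 1) / d)⁻¹ with hy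
    have hy0 : 0 < y := Real.rpow_pos_of_pos hs _
    obtain ⟨T, hT, hyT⟩ := hFunbdd y
    obtain ⟨t, ht, hty⟩ := intermediate_value_Ioc hT.le (hFcont T hT)
      (show y ∈ Ioc (F 0) (F T) from ⟨hF0.symm ▸ hy0, hyT⟩)
    exact ⟨t, ht.1, by rw [hNF t ht.1.le, hty, hy, Real.rpow_inv_rpow hs.le hp0.ne']⟩
  have hinv : ∀ t, 0 ≤ t → Function.invFunOn N (Ici 0) (N t) = t := fun t ht =>
    hNmono.injOn.leftInvOn_invFunOn ht
  have key : ∀ s, 0 < s → ∃ D, HasDerivAt Φstar D s ∧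
      (d : ℝ) * m / (d - m) ≤ s * D / Φstar s ∧ s * D / Φstar s ≤ (d : ℝ) * ℓ / (d - ℓ) := by
    intro s hs
    obtain ⟨t, ht, rfl⟩ := hsurj s hs
    have hFt := hFpos t ht
    have hgt := hgpos t ht
    have hΦt := hpos t ht
    set p : ℝ := ((d : ℝ) - 1) / d with hp
    have hND : HasStrictDerivAt N (p * F t ^ (p - 1) * g t) t := by
      refine ((Real.hasStrictDerivAt_rpow_const_of_ne hFt.ne' p).comp t
        (hFderiv t ht)).congr_of_eventuallyEq ?_
      filter_upwards [Ioi_mem_nhds ht] with x hx using (hNF x (le_of_lt hx)).symm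
    have hND0 : p * F t ^ (p - 1) * g t ≠ 0 := by positivity
    have hID := (hND.to_local_left_inverse (g := Function.invFunOn N (Ici 0)) hND0 (by
      filter_upwards [Ioi_mem_nhds ht] with x hx using hinv x (le_of_lt hx))).hasDerivAt
    have hD : HasDerivAt Φstar (φ t * (p * F t ^ (p - 1) * g t)⁻¹) (N t) := by
      rw [show Φstar = Φ ∘ Function.invFunOn N (Ici 0) from funext hΦstar]
      refine HasDerivAt.comp (N t) ?_ hID
      rw [hinv t ht.le]
      exact hderiv t ht
    refine ⟨_, hD, ?_⟩
    rw [hΦstar, hinv t ht.le]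
    have hval : N t * (φ t * (p * F t ^ (p - 1) * g t)⁻¹) / Φ t =
        (t * φ t / Φ t) * (F t / (p * (g t * t))) := by
      rw [hNF t ht.le, Real.rpow_sub_one hFt.ne']
      have : F t ^ p ≠ 0 := by positivity
      field_simp
    rw [hval]
    obtain ⟨hE1, hE2⟩ := helast t ht
    obtain ⟨-, hlo, hup⟩ := hprim t ht
    have hlo' : (d : ℝ) / (d - m) ≤ F t / (p * (g t * t)) := by
      rw [le_div_iff₀ (by positivity)]
      refine le_trans (le_of_eq ?_) hlo
      rw [hp]; field_simp
    have hup' : F t / (p * (g t * t)) ≤ (d : ℝ) / (d - ℓ) := by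
      rw [div_le_iff₀ (by positivity)]
      refine hup.trans (le_of_eq ?_)
      rw [hp]; field_simp
    rw [mul_comm (d : ℝ) m, mul_comm (d : ℝ) ℓ, mul_div_assoc m, mul_div_assoc ℓ]
    have hφt := hφpos t ht
    have hE0 : 0 ≤ t * φ t / Φ t := by positivity
    have hl0 : 0 ≤ ℓ := hE0.trans hE2
    constructor <;> gcongr
  choose! D hD using key
  exact ⟨D, fun t ht => (hD t ht).1, fun t ht => (hD t ht).2⟩
end

section
/- Let B and D be generalized Young functions on ℝ^d satisfying, for all x ∈ ℝ^d and t > 0, the elasticity bounds 1 < b⁻ ≤ t·∂ₜB(x,t)/B(x,t) ≤ b⁺ < ∞ and 1 < d⁻ ≤ t·∂ₜD(x,t)/D(x,t) ≤ d⁺ < ∞. Define the composition (D∘B)(x,t) := D(x, B(x,t)), and let u ∈ L^{D∘B}(ℝ^d) (with respect to Lebesgue measure). Then min{‖u‖_{L^{D∘B}}^{b⁺}, ‖u‖_{L^{D∘B}}^{b⁻}} ≤ ‖B(·,|u(·)|)‖_{L^D} ≤ max{‖u‖_{L^{D∘B}}^{b⁺}, ‖u‖_{L^{D∘B}}^{b⁻}}.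 -/
open Set MeasureTheory

/-- A positive function on `(0, ∞)` whose elasticity lies in `[p, q]` grows between the powers
`t ^ p` and `t ^ q`, in logarithmic form. -/
lemma log_sub_log_mem_Icc_of_elasticity {f f' : ℝ → ℝ} {p q : ℝ}
    (hderiv : ∀ t, 0 < t → HasDerivAt f (f' t) t) (hpos : ∀ t, 0 < t → 0 < f t)
    (helast : ∀ t, 0 < t → p ≤ t * f' t / f t ∧ t * f' t / f t ≤ q)
    {a b : ℝ} (ha : 0 < a) (hab : a ≤ b) :
    p * (Real.log b - Real.log a) ≤ Real.log (f b) - Real.log (f a) ∧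
      Real.log (f b) - Real.log (f a) ≤ q * (Real.log b - Real.log a) := by
  have hb : 0 < b := ha.trans_le hab
  have key (r : ℝ) (t : ℝ) (ht : 0 < t) :
      HasDerivAt (fun t => Real.log (f t) - r * Real.log t) ((t * f' t / f t - r) / t) t := by
    have h := ((hderiv t ht).log (hpos t ht).ne').sub ((Real.hasDerivAt_log ht.ne').const_mul r)
    refine h.congr_deriv ?_
    have hft := (hpos t ht).ne'
    have ht' := ht.ne'
    field_simp
  have hcont (r : ℝ) : ContinuousOn (fun t => Real.log (f t) - r * Real.log t) (Ioi 0) :=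
    fun t ht => (key r t ht).continuousAt.continuousWithinAt
  have hmono : MonotoneOn (fun t => Real.log (f t) - p * Real.log t) (Ioi 0) := by
    refine monotoneOn_of_deriv_nonneg (convex_Ioi 0) (hcont p) ?_ ?_ <;> rw [interior_Ioi]
    · exact fun t ht => (key p t ht).differentiableAt.differentiableWithinAt
    · intro t ht
      rw [(key p t ht).deriv]
      exact div_nonneg (sub_nonneg.2 (helast t ht).1) (le_of_lt ht)
  have hanti : AntitoneOn (fun t => Real.log (f t) - q * Real.log t) (Ioi 0) := by
    refine antitoneOn_of_deriv_nonpos (convex_Ioi 0) (hcont q) ?_ ?_ <;> rw [interior_Ioi]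
    · exact fun t ht => (key q t ht).differentiableAt.differentiableWithinAt
    · intro t ht
      rw [(key q t ht).deriv]
      exact div_nonpos_of_nonpos_of_nonneg (sub_nonpos.2 (helast t ht).2) (le_of_lt ht)
  have h1 := hmono (mem_Ioi.2 ha) (mem_Ioi.2 hb) hab
  have h2 := hanti (mem_Ioi.2 ha) (mem_Ioi.2 hb) hab
  simp only at h1 h2
  constructor <;> linarith

/-- Scaling inequalities for a function vanishing at `0` with elasticity in `[p, q]`. -/
lemma scaling_of_elasticity {f f' : ℝ → ℝ} {p q : ℝ}
    (hderiv : ∀ t, 0 < t → HasDerivAt f (f' t) t) (hpos : ∀ t, 0 < t → 0 < f t)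
    (helast : ∀ t, 0 < t → p ≤ t * f' t / f t ∧ t * f' t / f t ≤ q)
    (hzero : f 0 = 0) {c t : ℝ} (hc : 0 < c) (ht : 0 ≤ t) :
    min (c ^ q) (c ^ p) * f t ≤ f (c * t) ∧ f (c * t) ≤ max (c ^ q) (c ^ p) * f t := by
  rcases ht.eq_or_lt with rfl | ht
  · simp [hzero]
  have hct : 0 < c * t := mul_pos hc ht
  have hlog : Real.log (c * t) = Real.log c + Real.log t := Real.log_mul hc.ne' ht.ne'
  have hlogpow (r : ℝ) : Real.log (c ^ r * f t) = r * Real.log c + Real.log (f t) := by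
    rw [Real.log_mul (Real.rpow_pos_of_pos hc r).ne' (hpos t ht).ne', Real.log_rpow hc]
  have hprod (r : ℝ) : 0 < c ^ r * f t := mul_pos (Real.rpow_pos_of_pos hc r) (hpos t ht)
  rcases le_total 1 c with h | h
  · obtain ⟨h1, h2⟩ := log_sub_log_mem_Icc_of_elasticity hderiv hpos helast ht
      (le_mul_of_one_le_left ht.le h)
    have hl : c ^ p * f t ≤ f (c * t) := by
      rw [← Real.log_le_log_iff (hprod p) (hpos _ hct), hlogpow]
      rw [hlog] at h1
      linarith
    have hr : f (c * t) ≤ c ^ q * f t := by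
      rw [← Real.log_le_log_iff (hpos _ hct) (hprod q), hlogpow]
      rw [hlog] at h2
      linarith
    exact ⟨(mul_le_mul_of_nonneg_right (min_le_right _ _) (hpos t ht).le).trans hl,
      hr.trans (mul_le_mul_of_nonneg_right (le_max_left _ _) (hpos t ht).le)⟩
  · obtain ⟨h1, h2⟩ := log_sub_log_mem_Icc_of_elasticity hderiv hpos helast hct
      (mul_le_of_le_one_left ht.le h)
    have hl : c ^ q * f t ≤ f (c * t) := by
      rw [← Real.log_le_log_iff (hprod q) (hpos _ hct), hlogpow]
      rw [hlog] at h2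
      linarith
    have hr : f (c * t) ≤ c ^ p * f t := by
      rw [← Real.log_le_log_iff (hpos _ hct) (hprod p), hlogpow]
      rw [hlog] at h1
      linarith
    exact ⟨(mul_le_mul_of_nonneg_right (min_le_left _ _) (hpos t ht).le).trans hl,
      hr.trans (mul_le_mul_of_nonneg_right (le_max_right _ _) (hpos t ht).le)⟩

lemma ConvexOn.map_mul_le_mul_map {f : ℝ → ℝ} (hf : ConvexOn ℝ (Ici 0) f) (hzero : f 0 = 0)
    {c t : ℝ} (hc : 0 ≤ c) (hc1 : c ≤ 1) (ht : 0 ≤ t) : f (c * t) ≤ c * f t := by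
  simpa [hzero] using hf.2 (mem_Ici.2 ht) (mem_Ici.2 le_rfl) hc (sub_nonneg.2 hc1) (by ring)

lemma ConvexOn.monotoneOn_Ici_of_nonneg {f : ℝ → ℝ} (hf : ConvexOn ℝ (Ici 0) f)
    (hzero : f 0 = 0) (hnonneg : ∀ t, 0 ≤ t → 0 ≤ f t) : MonotoneOn f (Ici 0) := by
  intro a ha b hb hab
  rcases (mem_Ici.1 hb).eq_or_lt with rfl | hb'
  · rw [le_antisymm hab ha]
  have h := hf.map_mul_le_mul_map hzero (div_nonneg ha hb'.le) ((div_le_one hb').2 hab) hb'.le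
  rw [div_mul_cancel₀ _ hb'.ne'] at h
  exact h.trans (mul_le_of_le_one_left (hnonneg b hb) ((div_le_one hb').2 hab))

/-- A finite modular can be made at most `1` by dividing the argument by a large constant, as soon
as `Φ` is subhomogeneous. -/
lemma exists_mmodular_div_le_one {α : Type*} [MeasurableSpace α] {μ : Measure α}
    {Φ : α → ℝ → ℝ} {u : α → ℝ}
    (hΦ : ∀ᵐ x ∂μ, ∀ c t : ℝ, 0 ≤ c → c ≤ 1 → 0 ≤ t → Φ x (c * t) ≤ c * Φ x t)
    (hu : MemLPhi μ Φ u) : ∃ lam : ℝ, 0 < lam ∧ mmodular μ Φ (fun x => u x / lam) ≤ 1 := by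
  obtain ⟨-, k, hk, hfin⟩ := hu
  set M := (mmodular μ Φ (fun x => k * u x)).toReal with hM
  have hM0 : 0 ≤ M := ENNReal.toReal_nonneg
  have hM1 : 0 < M + 1 := by linarith
  have hc : (M + 1)⁻¹ ≤ 1 := inv_le_one_of_one_le₀ (by linarith)
  refine ⟨(M + 1) / k, div_pos hM1 hk, ?_⟩
  calc mmodular μ Φ (fun x => u x / ((M + 1) / k))
      ≤ ∫⁻ x, ENNReal.ofReal (M + 1)⁻¹ * ENNReal.ofReal (Φ x |k * u x|) ∂μ := by
        refine lintegral_mono_ae ?_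
        filter_upwards [hΦ] with x hx
        rw [← ENNReal.ofReal_mul (inv_nonneg.2 hM1.le)]
        refine ENNReal.ofReal_le_ofReal ?_
        have harg : |u x / ((M + 1) / k)| = (M + 1)⁻¹ * |k * u x| := by
          rw [show u x / ((M + 1) / k) = (M + 1)⁻¹ * (k * u x) by field_simp, abs_mul,
            abs_of_pos (inv_pos.2 hM1)]
        rw [harg]
        exact hx _ _ (inv_nonneg.2 hM1.le) hc (abs_nonneg _)
    _ = ENNReal.ofReal (M + 1)⁻¹ * ENNReal.ofReal M := by
        rw [lintegral_const_mul' _ _ ENNReal.ofReal_ne_top, hM, ENNReal.ofReal_toReal hfin.ne]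
        rfl
    _ ≤ 1 := by
        rw [← ENNReal.ofReal_mul (inv_nonneg.2 hM1.le), ENNReal.ofReal_le_one,
          inv_mul_le_one₀ hM1]
        linarith

lemma exists_min_rpow_eq {p q : ℝ} (hp : 0 < p) (hpq : p ≤ q) {m : ℝ} (hm : 0 < m) :
    ∃ c : ℝ, 0 < c ∧ min (c ^ q) (c ^ p) = m := by
  rcases le_total 1 m with h | h
  · refine ⟨m ^ p⁻¹, Real.rpow_pos_of_pos hm _, ?_⟩
    rw [min_eq_right (Real.rpow_le_rpow_of_exponent_le
      (Real.one_le_rpow h (inv_nonneg.2 hp.le)) hpq), Real.rpow_inv_rpow hm.le hp.ne']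
  · have hq : 0 < q := hp.trans_le hpq
    refine ⟨m ^ q⁻¹, Real.rpow_pos_of_pos hm _, ?_⟩
    rw [min_eq_left (Real.rpow_le_rpow_of_exponent_ge (Real.rpow_pos_of_pos hm _)
      (Real.rpow_le_one hm.le h (inv_nonneg.2 hq.le)) hpq), Real.rpow_inv_rpow hm.le hq.ne']

/-- Let `B, D` be generalized Young functions on `ℝ^d` with elasticity
bounds `1 < b⁻ ≤ b⁺ < ∞` resp. `1 < d⁻ ≤ d⁺ < ∞`, and let `u ∈ L^{D∘B}(ℝ^d)` where
`(D∘B)(x,t) = D(x,B(x,t))`. Then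
`min (‖u‖_{L^{D∘B}}^{b⁺}) (‖u‖_{L^{D∘B}}^{b⁻}) ≤ ‖B(·,|u|)‖_{L^D}
  ≤ max (‖u‖_{L^{D∘B}}^{b⁺}) (‖u‖_{L^{D∘B}}^{b⁻})`. -/
theorem stmt17
    (d : ℕ)
    (B D bB dD : EuclideanSpace ℝ (Fin d) → ℝ → ℝ)
    (bminus bplus dminus dplus : ℝ)
    -- B and D are generalized Young functions on ℝ^d
    (hBmeas : ∀ t : ℝ, 0 ≤ t → Measurable fun x => B x t)
    (hDmeas : ∀ t : ℝ, 0 ≤ t → Measurable fun x => D x t)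
    (hBnonneg : ∀ x, ∀ t : ℝ, 0 ≤ t → 0 ≤ B x t)
    (hDnonneg : ∀ x, ∀ t : ℝ, 0 ≤ t → 0 ≤ D x t)
    (hByoung : ∀ᵐ x ∂(volume : Measure (EuclideanSpace ℝ (Fin d))),
      ConvexOn ℝ (Set.Ici (0 : ℝ)) (B x) ∧ ContinuousOn (B x) (Set.Ici (0 : ℝ)) ∧
        B x 0 = 0 ∧ (∃ t : ℝ, 0 ≤ t ∧ B x t ≠ 0))
    (hDyoung : ∀ᵐ x ∂(volume : Measure (EuclideanSpace ℝ (Fin d))),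
      ConvexOn ℝ (Set.Ici (0 : ℝ)) (D x) ∧ ContinuousOn (D x) (Set.Ici (0 : ℝ)) ∧
        D x 0 = 0 ∧ (∃ t : ℝ, 0 ≤ t ∧ D x t ≠ 0))
    -- elasticity bounds for B, for all x ∈ ℝ^d and t > 0
    (h1b : 1 < bminus) (hbb : bminus ≤ bplus)
    (hBderiv : ∀ x, ∀ t : ℝ, 0 < t → HasDerivAt (B x) (bB x t) t)
    (hBpos : ∀ x, ∀ t : ℝ, 0 < t → 0 < B x t)
    (hBelast : ∀ x, ∀ t : ℝ, 0 < t →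
      bminus ≤ t * bB x t / B x t ∧ t * bB x t / B x t ≤ bplus)
    -- elasticity bounds for D, for all x ∈ ℝ^d and t > 0
    (h1d : 1 < dminus) (hdd : dminus ≤ dplus)
    (hDderiv : ∀ x, ∀ t : ℝ, 0 < t → HasDerivAt (D x) (dD x t) t)
    (hDpos : ∀ x, ∀ t : ℝ, 0 < t → 0 < D x t)
    (hDelast : ∀ x, ∀ t : ℝ, 0 < t →
      dminus ≤ t * dD x t / D x t ∧ t * dD x t / D x t ≤ dplus)
    -- u ∈ L^{D∘B}(ℝ^d), with respect to Lebesgue measure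
    (u : EuclideanSpace ℝ (Fin d) → ℝ)
    (hu : MemLPhi volume (fun x t => D x (B x t)) u) :
    min (luxNorm volume (fun x t => D x (B x t)) u ^ bplus)
        (luxNorm volume (fun x t => D x (B x t)) u ^ bminus) ≤
        luxNorm volume D (fun x => B x |u x|) ∧
      luxNorm volume D (fun x => B x |u x|) ≤
        max (luxNorm volume (fun x t => D x (B x t)) u ^ bplus)
          (luxNorm volume (fun x t => D x (B x t)) u ^ bminus) := by
  have hp : 0 < bminus := one_pos.trans h1b
  have hq : 0 < bplus := hp.trans_le hbb
  let S := {lam : ℝ | 0 < lam ∧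
    mmodular volume (fun x t => D x (B x t)) (fun x => u x / lam) ≤ 1}
  let T := {lam : ℝ | 0 < lam ∧ mmodular volume D (fun x => B x |u x| / lam) ≤ 1}
  have hDmono : ∀ᵐ x ∂(volume : Measure (EuclideanSpace ℝ (Fin d))),
      MonotoneOn (D x) (Ici 0) := by
    filter_upwards [hDyoung] with x hD
    exact hD.1.monotoneOn_Ici_of_nonneg hD.2.2.1 (hDnonneg x)
  have hSne : S.Nonempty := by
    refine exists_mmodular_div_le_one ?_ hu
    filter_upwards [hByoung, hDyoung, hDmono] with x hB hD hDm c t hc hc1 ht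
    have hBt := hBnonneg x t ht
    exact (hDm (mem_Ici.2 (hBnonneg x _ (mul_nonneg hc ht))) (mem_Ici.2 (mul_nonneg hc hBt))
      (hB.1.map_mul_le_mul_map hB.2.2.1 hc hc1 ht)).trans
      (hD.1.map_mul_le_mul_map hD.2.2.1 hc hc1 hBt)
  have hSbdd : BddBelow S := ⟨0, fun _ h => h.1.le⟩
  have hTbdd : BddBelow T := ⟨0, fun _ h => h.1.le⟩
  have hST : ∀ lam ∈ S, max (lam ^ bplus) (lam ^ bminus) ∈ T := by
    rintro lam ⟨hlam, hle⟩
    have hmax : 0 < max (lam ^ bplus) (lam ^ bminus) :=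
      lt_max_of_lt_left (Real.rpow_pos_of_pos hlam _)
    refine ⟨hmax, (lintegral_mono_ae ?_).trans hle⟩
    filter_upwards [hByoung, hDmono] with x hB hDm
    refine ENNReal.ofReal_le_ofReal (hDm (mem_Ici.2 (abs_nonneg _))
      (mem_Ici.2 (hBnonneg x _ (abs_nonneg _))) ?_)
    rw [abs_of_nonneg (div_nonneg (hBnonneg x _ (abs_nonneg _)) hmax.le), div_le_iff₀' hmax]
    have h := (scaling_of_elasticity (hBderiv x) (hBpos x) (hBelast x) hB.2.2.1 hlam
      (abs_nonneg (u x / lam))).2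
    rw [abs_div, abs_of_pos hlam, mul_div_cancel₀ _ hlam.ne'] at h
    rwa [abs_div, abs_of_pos hlam]
  have hTne : T.Nonempty := hSne.imp' _ hST
  have hTS : ∀ c : ℝ, 0 < c → min (c ^ bplus) (c ^ bminus) ∈ T → c ∈ S := by
    rintro c hc ⟨hmin, hle⟩
    refine ⟨hc, (lintegral_mono_ae ?_).trans hle⟩
    filter_upwards [hByoung, hDmono] with x hB hDm
    refine ENNReal.ofReal_le_ofReal (hDm (mem_Ici.2 (hBnonneg x _ (abs_nonneg _)))
      (mem_Ici.2 (abs_nonneg _)) ?_)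
    rw [abs_of_nonneg (div_nonneg (hBnonneg x _ (abs_nonneg _)) hmin.le), le_div_iff₀' hmin]
    have h := (scaling_of_elasticity (hBderiv x) (hBpos x) (hBelast x) hB.2.2.1 hc
      (abs_nonneg (u x / c))).1
    rw [abs_div, abs_of_pos hc, mul_div_cancel₀ _ hc.ne'] at h
    rwa [abs_div, abs_of_pos hc]
  have hN : 0 ≤ sInf S := Real.sInf_nonneg fun _ h => h.1.le
  change min (sInf S ^ bplus) (sInf S ^ bminus) ≤ sInf T ∧
    sInf T ≤ max (sInf S ^ bplus) (sInf S ^ bminus)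
  constructor
  · refine le_csInf hTne fun m hm => ?_
    obtain ⟨c, hc, rfl⟩ := exists_min_rpow_eq hp hbb hm.1
    have hle : sInf S ≤ c := csInf_le hSbdd (hTS c hc hm)
    exact min_le_min (Real.rpow_le_rpow hN hle hq.le) (Real.rpow_le_rpow hN hle hp.le)
  · have hclosed : IsClosed {lam : ℝ | sInf T ≤ max (lam ^ bplus) (lam ^ bminus)} :=
      isClosed_le continuous_const
        ((Real.continuous_rpow_const hq.le).max (Real.continuous_rpow_const hp.le))
    exact closure_minimal (fun lam hlam => csInf_le hTbdd (hST lam hlam)) hclosed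
      (csInf_mem_closure hSne hSbdd)
end

section
/- Let Φ be a Young function, differentiable on (0,∞) with derivative φ, with Φ(t) > 0 for t > 0, t·φ(t) ≥ Φ(t) for all t > 0, and Φ(t) → ∞ as t → ∞; let a > 0 be the (unique) point with Φ(a) = 1. Define Φ̂ : [0,∞) → [0,∞) by Φ̂(t) = t for 0 ≤ t < 1 and Φ̂(t) = 2·max{Φ(a·t), 2t − 1} − 1 for t ≥ 1. Then the function t ↦ Φ̂(t)/t is nondecreasing on (0,∞). -/
open Set Filter

/-- A convex function on `[0,∞)` vanishing at `0` is star-shaped: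
`t Φ(s) ≤ s Φ(t)` for `0 ≤ s ≤ t`. -/
theorem ConvexOn.mul_le_mul_of_map_zero {Φ : ℝ → ℝ} (hconv : ConvexOn ℝ (Set.Ici (0 : ℝ)) Φ)
    (hΦ0 : Φ 0 = 0) {s t : ℝ} (hs : 0 ≤ s) (hst : s ≤ t) : t * Φ s ≤ s * Φ t := by
  rcases (hs.trans hst).eq_or_lt with rfl | ht
  · simp [le_antisymm hst hs]
  have h := hconv.2 (Set.mem_Ici.2 le_rfl) (Set.mem_Ici.2 ht.le)
    (sub_nonneg.2 ((div_le_one ht).2 hst)) (div_nonneg hs ht.le) (sub_add_cancel 1 (s / t))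
  simp only [smul_eq_mul, mul_zero, zero_add, hΦ0, div_mul_cancel₀ s ht.ne'] at h
  calc t * Φ s ≤ t * (s / t * Φ t) := mul_le_mul_of_nonneg_left h ht.le
    _ = s * Φ t := by field_simp

/-- Let `Φ` be a Young function with derivative `φ`, `Φ(t) > 0` for
`t > 0`, `t φ(t) ≥ Φ(t)` for all `t > 0`, and `Φ(t) → ∞` as `t → ∞`; let `a > 0` be the
point with `Φ(a) = 1`, and define `Φ̂(t) = t` for `0 ≤ t < 1` and
`Φ̂(t) = 2 max (Φ(a t)) (2t − 1) − 1` for `t ≥ 1`. Then `t ↦ Φ̂(t)/t` is nondecreasing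
on `(0,∞)`. -/
theorem stmt18
    (Φ φ Φhat : ℝ → ℝ) (a : ℝ)
    -- Φ is a Young function
    (hconv : ConvexOn ℝ (Set.Ici (0 : ℝ)) Φ)
    (hcont : ContinuousOn Φ (Set.Ici (0 : ℝ)))
    (hΦ0 : Φ 0 = 0)
    (hnonneg : ∀ t : ℝ, 0 ≤ t → 0 ≤ Φ t)
    (hnonconst : ∃ t : ℝ, 0 ≤ t ∧ Φ t ≠ 0)
    -- Φ is differentiable on (0,∞) with derivative φ, positive, t φ(t) ≥ Φ(t), Φ → ∞
    (hderiv : ∀ t : ℝ, 0 < t → HasDerivAt Φ (φ t) t)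
    (hpos : ∀ t : ℝ, 0 < t → 0 < Φ t)
    (hineq : ∀ t : ℝ, 0 < t → Φ t ≤ t * φ t)
    (hinf : Tendsto Φ atTop atTop)
    -- a is the unique point with Φ(a) = 1
    (ha : 0 < a) (hΦa : Φ a = 1)
    (hauniq : ∀ t : ℝ, 0 < t → Φ t = 1 → t = a)
    -- the definition of Φ̂
    (hΦhat1 : ∀ t : ℝ, 0 ≤ t → t < 1 → Φhat t = t)
    (hΦhat2 : ∀ t : ℝ, 1 ≤ t → Φhat t = 2 * max (Φ (a * t)) (2 * t - 1) - 1) :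
    MonotoneOn (fun t => Φhat t / t) (Set.Ioi (0 : ℝ)) := by
  intro x hx y hy hxy
  have hx : 0 < x := hx
  have hy : 0 < y := hy
  change Φhat x / x ≤ Φhat y / y
  rw [div_le_div_iff₀ hx hy]
  rcases lt_or_ge y 1 with hy1 | hy1
  · rw [hΦhat1 x hx.le (hxy.trans_lt hy1), hΦhat1 y hy.le hy1, mul_comm]
  have hmaxl := le_max_left (Φ (a * y)) (2 * y - 1)
  have hmaxr := le_max_right (Φ (a * y)) (2 * y - 1)
  rw [hΦhat2 y hy1]
  rcases lt_or_ge x 1 with hx1 | hx1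
  · rw [hΦhat1 x hx.le hx1]
    nlinarith
  · rw [hΦhat2 x hx1]
    rcases max_choice (Φ (a * x)) (2 * x - 1) with h | h <;> rw [h]
    · have hstar := hconv.mul_le_mul_of_map_zero hΦ0 (mul_pos ha hx).le
        (mul_le_mul_of_nonneg_left hxy ha.le)
      rw [mul_assoc, mul_assoc, mul_le_mul_iff_right₀ ha] at hstar
      nlinarith
    · nlinarith
end
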